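/- arXiv:2509.00409 — 3 statements merged into one kernel-verified Lean document; each statement's English description precedes it below -/
import Mathlib

section
/- (Classification of irreducible doubly commuting representations.) Let V be a strongly continuous, doubly commuting isometric representation of ℝ₊^d on a nonzero separable complex Hilbert space H which is irreducible, i.e. every bounded operator on H commuting with all V_t and all V_t* is a scalar multiple of the identity. Then there exist a unique subset A ⊆ {1,…,d} and a unique function λ : {1,…,d}∖A → ℝ, together with a unitary U : H → L²(ℝ₊^A) (where L²(ℝ₊^∅) := ℂ), such that for all t ∈ ℝ₊^d, U V_t U* = e^{i Σ_{j ∉ A} t_j λ_j} · S_{t|_A}, where t|_A = (t_i)_{i∈A} ∈ ℝ₊^A and S = (S_s)_{s∈ℝ₊^A} is the shift semigroup on L²(ℝ₊^A) given by (S_s f)(x) = f(x−s) if x−s ∈ ℝ₊^A and 0 otherwise. -/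
open ContinuousLinearMap Filter Topology MeasureTheory

/-- Lebesgue measure on `ℝ^ι` restricted to the nonnegative cone `ℝ₊^ι`. -/
noncomputable def coneMeasure (ι : Type) [Fintype ι] : Measure (ι → ℝ) :=
  (volume : Measure (ι → ℝ)).restrict {x | ∀ i, 0 ≤ x i}

/-- `S` is the shift semigroup of `ℝ₊^ι` on `L²(ℝ₊^ι)`:
`(S_t f)(x) = f(x - t)` if `x - t ∈ ℝ₊^ι` and `0` otherwise, a.e. -/
def IsShiftFamily (ι : Type) [Fintype ι]
    (S : (ι → NNReal) → (Lp ℂ 2 (coneMeasure ι) →L[ℂ] Lp ℂ 2 (coneMeasure ι))) : Prop :=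
  ∀ (t : ι → NNReal) (f : Lp ℂ 2 (coneMeasure ι)),
    (S t f : (ι → ℝ) → ℂ) =ᵐ[coneMeasure ι]
      Set.indicator {x : ι → ℝ | ∀ i, (t i : ℝ) ≤ x i}
        (fun x => f (x - fun i => (t i : ℝ)))

/-- `V` is unitarily equivalent, via some unitary `U : H → L²(ℝ₊^A)`, to the representation
`t ↦ e^{i Σ_{j ∉ A} t_j λ_j} S_{t|_A}`, where `S` is the shift semigroup on `L²(ℝ₊^A)`. -/
def ClassifiedBy {d : ℕ} (H : Type*) [NormedAddCommGroup H] [InnerProductSpace ℂ H]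
    (V : (Fin d → NNReal) → H →L[ℂ] H) (A : Finset (Fin d)) (lam : Fin d → ℝ) : Prop :=
  ∃ (U : H ≃ₗᵢ[ℂ] Lp ℂ 2 (coneMeasure {i : Fin d // i ∈ A}))
    (S : ({i : Fin d // i ∈ A} → NNReal) →
      (Lp ℂ 2 (coneMeasure {i : Fin d // i ∈ A}) →L[ℂ]
        Lp ℂ 2 (coneMeasure {i : Fin d // i ∈ A}))),
    IsShiftFamily _ S ∧
    ∀ (t : Fin d → NNReal) (ξ : H),
      U (V t ξ) = Complex.exp (Complex.I * ((∑ j ∈ Aᶜ, (t j : ℝ) * lam j : ℝ) : ℂ)) •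
        S (fun i => t i.1) (U ξ)

section Semigroup

variable {E : Type*} [NormedAddCommGroup E] [InnerProductSpace ℂ E]

/-- A strongly continuous one-parameter semigroup of contractions. -/
structure IsContractionSemigroup (C : NNReal → E →L[ℂ] E) : Prop where
  zero : C 0 = 1
  add : ∀ s t, C (s + t) = C s * C t
  norm_le : ∀ t x, ‖C t x‖ ≤ ‖x‖
  cont : ∀ x, Continuous fun t => C t x

namespace IsContractionSemigroup

variable {C : NNReal → E →L[ℂ] E}

lemma add_apply (hC : IsContractionSemigroup C) (s t : NNReal) (x : E) :
    C (s + t) x = C s (C t x) := by rw [hC.add]; rfl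

lemma continuous_orbit (hC : IsContractionSemigroup C) (x : E) :
    Continuous fun s : ℝ => C s.toNNReal x :=
  (hC.cont x).comp continuous_real_toNNReal

lemma continuous_weighted (hC : IsContractionSemigroup C) (x : E) :
    Continuous fun s : ℝ => Real.exp (-s) • C s.toNNReal x :=
  (Real.continuous_exp.comp continuous_neg).smul (hC.continuous_orbit x)

lemma integrableOn_weighted (hC : IsContractionSemigroup C) (x : E) (a : ℝ) :
    IntegrableOn (fun s : ℝ => Real.exp (-s) • C s.toNNReal x) (Set.Ioi a) := by
  refine ((integrableOn_exp_neg_Ioi a).mul_const ‖x‖).mono'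
    (hC.continuous_weighted x).aestronglyMeasurable (ae_of_all _ fun s => ?_)
  rw [norm_smul, Real.norm_eq_abs, Real.abs_exp]
  gcongr
  exact hC.norm_le _ _

/-- The resolvent `∫₀^∞ e^{-s} C_s ds` of a contraction semigroup. -/
noncomputable def resolvent (hC : IsContractionSemigroup C) : E →L[ℂ] E :=
  LinearMap.mkContinuous
    { toFun := fun x => ∫ s in Set.Ioi (0 : ℝ), Real.exp (-s) • C s.toNNReal x
      map_add' := fun x y => by
        rw [← integral_add (hC.integrableOn_weighted x 0) (hC.integrableOn_weighted y 0)]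
        simp
      map_smul' := fun c x => by
        rw [RingHom.id_apply, ← integral_smul]
        congr 1 with s
        rw [map_smul, smul_comm] } 1 fun x => by
    refine (norm_integral_le_of_norm_le ((integrableOn_exp_neg_Ioi 0).mul_const ‖x‖)
      (ae_of_all _ fun s => ?_)).trans_eq ?_
    · rw [norm_smul, Real.norm_eq_abs, Real.abs_exp]
      gcongr
      exact hC.norm_le _ _
    · rw [integral_mul_const, integral_exp_neg_Ioi_zero]

lemma resolvent_apply (hC : IsContractionSemigroup C) (x : E) :
    hC.resolvent x = ∫ s in Set.Ioi (0 : ℝ), Real.exp (-s) • C s.toNNReal x := rfl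

lemma setIntegral_Ioi (hC : IsContractionSemigroup C) (x : E) (t : ℝ) :
    ∫ s in Set.Ioi t, Real.exp (-s) • C s.toNNReal x =
      hC.resolvent x - ∫ s in (0 : ℝ)..t, Real.exp (-s) • C s.toNNReal x := by
  rw [resolvent_apply, ← intervalIntegral.integral_interval_add_Ioi'
    ((hC.continuous_weighted x).intervalIntegrable 0 t) (hC.integrableOn_weighted x t)]
  abel

lemma resolvent_comp (hC : IsContractionSemigroup C) {t : ℝ} (ht : 0 ≤ t) (x : E) :
    hC.resolvent (C t.toNNReal x) = Real.exp t •
      (hC.resolvent x - ∫ s in (0 : ℝ)..t, Real.exp (-s) • C s.toNNReal x) := by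
  rw [← hC.setIntegral_Ioi, resolvent_apply, ← integral_smul,
    ← (measurePreserving_add_right volume t).setIntegral_preimage_emb
      (measurableEmbedding_addRight t)
      (fun s => Real.exp t • Real.exp (-s) • C s.toNNReal x) (Set.Ioi t),
    Set.preimage_add_const_Ioi, sub_self]
  refine setIntegral_congr_fun measurableSet_Ioi fun s hs => ?_
  rw [Real.toNNReal_add (le_of_lt hs) ht, hC.add_apply, smul_smul, ← Real.exp_add]
  congr 2
  ring

lemma apply_resolvent [CompleteSpace E] (hC : IsContractionSemigroup C) (t : NNReal) (x : E) :
    C t (hC.resolvent x) = hC.resolvent (C t x) := by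
  rw [resolvent_apply, ← ContinuousLinearMap.integral_comp_comm _ (hC.integrableOn_weighted x 0),
    resolvent_apply]
  congr 1 with s
  rw [ContinuousLinearMap.map_smul_of_tower, ← hC.add_apply, add_comm, hC.add_apply]

/-- An everywhere differentiable extension of `t ↦ R (C_t x)` from `[0, ∞)` to `ℝ`. -/
lemma hasDerivAt_extension [CompleteSpace E] (hC : IsContractionSemigroup C) (x : E) (t : ℝ) :
    HasDerivAt (fun t => Real.exp t •
      (hC.resolvent x - ∫ s in (0 : ℝ)..t, Real.exp (-s) • C s.toNNReal x))
      (Real.exp t • (hC.resolvent x - ∫ s in (0 : ℝ)..t, Real.exp (-s) • C s.toNNReal x)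
        - C t.toNNReal x) t := by
  have h := (Real.hasDerivAt_exp t).smul
    (((hC.continuous_weighted x).integral_hasStrictDerivAt 0 t).hasDerivAt.const_sub
      (hC.resolvent x))
  convert! h using 1
  rw [smul_neg, smul_smul, ← Real.exp_add]
  simp
  abel

lemma hasDerivWithinAt_resolvent [CompleteSpace E] (hC : IsContractionSemigroup C) (x : E)
    {t : ℝ} (ht : 0 ≤ t) :
    HasDerivWithinAt (fun s : ℝ => hC.resolvent (C s.toNNReal x))
      (hC.resolvent (C t.toNNReal x) - C t.toNNReal x) (Set.Ici t) t := by
  rw [hC.resolvent_comp ht x]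
  exact (hC.hasDerivAt_extension x t).hasDerivWithinAt.congr
    (fun s hs => hC.resolvent_comp (ht.trans hs) x) (hC.resolvent_comp ht x)

lemma resolvent_injective [CompleteSpace E] (hC : IsContractionSemigroup C) (x : E)
    (hx : hC.resolvent x = 0) : x = 0 := by
  have h0 := hC.hasDerivWithinAt_resolvent x le_rfl
  have : (fun s : ℝ => hC.resolvent (C s.toNNReal x)) = fun _ => 0 := by
    funext s
    rw [← hC.apply_resolvent, hx, map_zero]
  rw [this] at h0
  have h1 := (uniqueDiffOn_Ici (0 : ℝ) 0 Set.self_mem_Ici).eq_deriv _ h0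
    (hasDerivWithinAt_const (0 : ℝ) _ (0 : E))
  simpa [hC.zero, hx] using h1


variable [CompleteSpace E]

lemma adjoint_norm_le (hC : IsContractionSemigroup C) (t : NNReal) (x : E) :
    ‖adjoint (C t) x‖ ≤ ‖x‖ := by
  refine ((adjoint (C t)).le_of_opNorm_le (?_ : _ ≤ (1 : ℝ)) x).trans_eq (one_mul _)
  rw [LinearIsometryEquiv.norm_map]
  exact ContinuousLinearMap.opNorm_le_bound _ zero_le_one fun y => by
    simpa using hC.norm_le t y

lemma adjoint_sub_self_norm_le (hC : IsContractionSemigroup C) (t : NNReal) (x : E)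
    (hiso : ‖C t x‖ = ‖x‖) : ‖adjoint (C t) x - x‖ ≤ ‖C t x - x‖ := by
  refine le_of_sq_le_sq ?_ (norm_nonneg _)
  rw [norm_sub_sq (𝕜 := ℂ), norm_sub_sq (𝕜 := ℂ), adjoint_inner_left, hiso, inner_re_symm]
  gcongr
  exact hC.adjoint_norm_le t x

/-- The adjoints of a strongly continuous isometric semigroup form a strongly continuous
contraction semigroup. -/
lemma adjoint_of_isometry (hC : IsContractionSemigroup C) (hiso : ∀ t x, ‖C t x‖ = ‖x‖) :
    IsContractionSemigroup fun t => adjoint (C t) := by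
  have hadd : ∀ s t, adjoint (C (s + t)) = adjoint (C s) * adjoint (C t) := fun s t => by
    rw [add_comm, hC.add]
    exact adjoint_comp _ _
  refine ⟨by rw [hC.zero]; exact adjoint_id, hadd, hC.adjoint_norm_le, fun x => ?_⟩
  have key : ∀ s t : NNReal, s ≤ t →
      ‖adjoint (C t) x - adjoint (C s) x‖ ≤ ‖C (t - s) x - x‖ := fun s t hst => by
    rw [show adjoint (C t) = adjoint (C s) * adjoint (C (t - s)) by
      rw [← hadd, add_tsub_cancel_of_le hst], mul_apply_eq_comp, ← map_sub]
    exact (hC.adjoint_norm_le _ _).trans (hC.adjoint_sub_self_norm_le _ _ (hiso _ _))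
  have key' : ∀ s t : NNReal,
      ‖adjoint (C t) x - adjoint (C s) x‖ ≤ ‖C (t - s) x - x‖ + ‖C (s - t) x - x‖ := by
    intro s t
    rcases le_total s t with h | h
    · exact (key s t h).trans (le_add_of_nonneg_right (norm_nonneg _))
    · rw [norm_sub_rev]
      exact (key t s h).trans (le_add_of_nonneg_left (norm_nonneg _))
  refine continuous_iff_continuousAt.2 fun s => ?_
  rw [ContinuousAt, tendsto_iff_norm_sub_tendsto_zero]
  refine squeeze_zero (fun _ => norm_nonneg _) (key' s) ?_
  have hc : Continuous fun t : NNReal => ‖C (t - s) x - x‖ + ‖C (s - t) x - x‖ :=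
    (((hC.cont x).comp (continuous_id.sub continuous_const)).sub continuous_const).norm.add
      (((hC.cont x).comp (continuous_const.sub continuous_id)).sub continuous_const).norm
  have := hc.tendsto s
  simpa [hC.zero] using this

lemma adjoint_comp_self {V : NNReal → E →L[ℂ] E} (hiso : ∀ t x, ‖V t x‖ = ‖x‖) (t : NNReal)
    (x : E) : adjoint (V t) (V t x) = x :=
  congr($((ContinuousLinearMap.norm_map_iff_adjoint_comp_self (V t)).1 (hiso t)) x)

variable {V : NNReal → E →L[ℂ] E}

lemma resolvent_adjoint (hV : IsContractionSemigroup V) (hiso : ∀ t x, ‖V t x‖ = ‖x‖) :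
    (hV.adjoint_of_isometry hiso).resolvent = adjoint hV.resolvent := by
  rw [ContinuousLinearMap.eq_adjoint_iff]
  intro x y
  have hV' := hV.adjoint_of_isometry hiso
  rw [← inner_conj_symm, resolvent_apply, resolvent_apply,
    ← integral_inner (hV'.integrableOn_weighted x 0), ← integral_inner
    (hV.integrableOn_weighted y 0), ← integral_conj]
  congr 1 with s
  rw [inner_conj_symm, RCLike.real_smul_eq_coe_smul (K := ℂ), RCLike.real_smul_eq_coe_smul (K := ℂ),
    inner_smul_left, inner_smul_right, adjoint_inner_left, RCLike.conj_ofReal]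

/-- The isometric semigroup as acted on by the adjoint resolvent. -/
lemma resolvent_adjoint_comp (hV : IsContractionSemigroup V) (hiso : ∀ t x, ‖V t x‖ = ‖x‖)
    {t : ℝ} (ht : 0 ≤ t) (x : E) :
    adjoint hV.resolvent (V t.toNNReal x) = Real.exp (-t) •
      (adjoint hV.resolvent x + ∫ s in (0 : ℝ)..t, Real.exp s • V s.toNNReal x) := by
  have hV' := hV.adjoint_of_isometry hiso
  rw [← hV.resolvent_adjoint hiso]
  have h1 : ∫ s in (0 : ℝ)..t, Real.exp (-s) • adjoint (V s.toNNReal) (V t.toNNReal x) =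
      Real.exp (-t) • ∫ s in (0 : ℝ)..t, Real.exp s • V s.toNNReal x := by
    rw [← intervalIntegral.integral_smul]
    have := intervalIntegral.integral_comp_sub_left (a := 0) (b := t)
      (fun s => Real.exp (-t) • Real.exp s • V s.toNNReal x) t
    rw [sub_self, sub_zero] at this
    rw [← this]
    refine intervalIntegral.integral_congr fun s hs => ?_
    rw [Set.uIcc_of_le ht] at hs
    have h2 : V t.toNNReal x = V s.toNNReal (V (t - s).toNNReal x) := by
      rw [← hV.add_apply, ← Real.toNNReal_add hs.1 (sub_nonneg.2 hs.2), add_sub_cancel]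
    rw [h2, adjoint_comp_self hiso, smul_smul, ← Real.exp_add]
    congr 2
    ring
  have h3 := hV'.resolvent_comp ht (V t.toNNReal x)
  rw [adjoint_comp_self hiso, eq_comm, ← eq_inv_smul_iff₀ (Real.exp_ne_zero t),
    sub_eq_iff_eq_add, h1, ← Real.exp_neg] at h3
  rw [h3, smul_add]

/-- If `P = R + R* - 2 R R*`, then `P V_t = e^{-t} P`. -/
lemma defect_comp (hV : IsContractionSemigroup V) (hiso : ∀ t x, ‖V t x‖ = ‖x‖)
    {t : ℝ} (ht : 0 ≤ t) (x : E) :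
    hV.resolvent (V t.toNNReal x) + adjoint hV.resolvent (V t.toNNReal x)
      - (2 : ℝ) • hV.resolvent (adjoint hV.resolvent (V t.toNNReal x)) = Real.exp (-t) •
      (hV.resolvent x + adjoint hV.resolvent x
        - (2 : ℝ) • hV.resolvent (adjoint hV.resolvent x)) := by
  set R := hV.resolvent with hR
  set J : ℝ → E := fun t => ∫ s in (0 : ℝ)..t, Real.exp s • V s.toNNReal x with hJ
  have hJd : ∀ t, HasDerivAt J (Real.exp t • V t.toNNReal x) t := fun t =>
    ((Real.continuous_exp.smul (hV.continuous_orbit x)).integral_hasStrictDerivAt 0 t).hasDerivAt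
  have hφ : ∀ s, 0 ≤ s → HasDerivWithinAt
      (fun s : ℝ => Real.exp s • R (V s.toNNReal x) + J s - (2 : ℝ) • R (J s)) 0 (Set.Ici s) s := by
    intro s hs
    have hRJ : HasDerivAt (fun s => R (J s)) (R (Real.exp s • V s.toNNReal x)) s :=
      (R.restrictScalars ℝ).hasFDerivAt.comp_hasDerivAt s (hJd s)
    have := (((Real.hasDerivAt_exp s).hasDerivWithinAt.smul
      (hV.hasDerivWithinAt_resolvent x hs)).add (hJd s).hasDerivWithinAt).sub
      (hRJ.hasDerivWithinAt.const_smul (2 : ℝ))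
    convert! this using 1
    rw [ContinuousLinearMap.map_smul_of_tower, two_smul]
    module
  have hcont : Continuous
      fun s : ℝ => Real.exp s • R (V s.toNNReal x) + J s - (2 : ℝ) • R (J s) := by
    have hJc : Continuous J := continuous_iff_continuousAt.2 fun s => (hJd s).continuousAt
    exact ((Real.continuous_exp.smul (R.continuous.comp (hV.continuous_orbit x))).add hJc).sub
      ((R.continuous.comp hJc).const_smul (2 : ℝ))
  have hconst := constant_of_has_deriv_right_zero (b := t) hcont.continuousOn
    (fun s hs => hφ s hs.1) t ⟨ht, le_rfl⟩
  simp only [hJ, intervalIntegral.integral_same, map_zero, smul_zero, Real.exp_zero, one_smul,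
    Real.toNNReal_zero, hV.zero, one_apply_eq_self, add_zero, sub_zero] at hconst
  rw [hV.resolvent_adjoint_comp hiso ht, ← hR, ← hconst, ContinuousLinearMap.map_smul_of_tower,
    map_add]
  have he : R (V t.toNNReal x) = Real.exp (-t) • Real.exp t • R (V t.toNNReal x) := by
    rw [smul_smul, ← Real.exp_add, neg_add_cancel, Real.exp_zero, one_smul]
  nth_rewrite 1 [he]
  module

/-- If `R + R* = 2 R R*`, then the semigroup is unitary. -/
lemma surjective_of_defect_eq_zero (hV : IsContractionSemigroup V)
    (hiso : ∀ t x, ‖V t x‖ = ‖x‖)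
    (h0 : ∀ x, hV.resolvent x + adjoint hV.resolvent x
      - (2 : ℝ) • hV.resolvent (adjoint hV.resolvent x) = 0) (t : NNReal) :
    Function.Surjective (V t) := by
  have hV' := hV.adjoint_of_isometry hiso
  set R' := adjoint hV.resolvent with hR'
  have hRR : hV'.resolvent = R' := hV.resolvent_adjoint hiso
  have hd : ∀ x (s : ℝ), 0 ≤ s → HasDerivWithinAt
      (fun s : ℝ => ‖R' (adjoint (V s.toNNReal) x)‖ ^ 2) 0 (Set.Ici s) s := by
    intro x s hs
    have h1 := hV'.hasDerivWithinAt_resolvent x hs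
    rw [hRR] at h1
    let _ : InnerProductSpace ℝ E := InnerProductSpace.rclikeToReal ℂ E
    convert! h1.norm_sq using 1
    set u := adjoint (V s.toNNReal) x
    have hadj : ∀ z, inner ℂ u (hV.resolvent z) = inner ℂ (R' u) z :=
      fun z => (adjoint_inner_left _ _ _).symm
    have h2 : inner ℂ u (hV.resolvent u + R' u - (2 : ℝ) • hV.resolvent (R' u)) = 0 := by
      rw [h0, inner_zero_right]
    rw [inner_sub_right, inner_add_right, RCLike.real_smul_eq_coe_smul (K := ℂ),
      inner_smul_right, hadj, hadj] at h2
    have h3 := congr(RCLike.re $h2)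
    rw [real_inner_eq_re_inner ℂ, inner_sub_right]
    have h4 : RCLike.re (inner ℂ u (R' u)) = RCLike.re (inner ℂ (R' u) u) := inner_re_symm _ _
    simp at h3 h4 ⊢
    linarith
  have hnorm : ∀ x, ‖adjoint (V t) (R' x)‖ = ‖R' x‖ := by
    intro x
    have hcont : Continuous fun s : ℝ => ‖R' (adjoint (V s.toNNReal) x)‖ ^ 2 := by
      have := hV'.continuous_orbit x
      fun_prop
    have := constant_of_has_deriv_right_zero (b := (t : ℝ)) hcont.continuousOn
      (fun s hs => hd x s hs.1) t ⟨t.2, le_rfl⟩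
    rw [← hRR, hV'.apply_resolvent, hRR]
    simp only [Real.toNNReal_coe, Real.toNNReal_zero, hV'.zero] at this
    exact (pow_left_inj₀ (norm_nonneg _) (norm_nonneg _) two_ne_zero).1 this
  have hdense : DenseRange R' := by
    have : R'.range.topologicalClosure = ⊤ := by
      rw [Submodule.topologicalClosure_eq_top_iff, ContinuousLinearMap.orthogonal_range,
        hR', adjoint_adjoint, LinearMap.ker_eq_bot']
      exact hV.resolvent_injective
    exact (Submodule.dense_iff_topologicalClosure_eq_top).2 this
  have hall : ∀ y, ‖adjoint (V t) y‖ = ‖y‖ := by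
    intro y
    refine hdense.induction_on (p := fun y => ‖adjoint (V t) y‖ = ‖y‖) y ?_ hnorm
    exact isClosed_eq (by fun_prop) continuous_norm
  have := (ContinuousLinearMap.norm_map_iff_adjoint_comp_self (adjoint (V t))).1 hall
  rw [adjoint_adjoint] at this
  exact fun y => ⟨adjoint (V t) y, congr($this y)⟩

/-- A strongly continuous isometric semigroup that is not unitary has a joint eigenvector of its
adjoints, with eigenvalue `e^{-t}`. -/
lemma exists_adjoint_eigenvector (hV : IsContractionSemigroup V)
    (hiso : ∀ t x, ‖V t x‖ = ‖x‖) (hns : ∃ t, ¬ Function.Surjective (V t)) :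
    ∃ ξ : E, ξ ≠ 0 ∧ ∀ t, adjoint (V t) ξ = Real.exp (-t) • ξ := by
  by_contra! hcon
  obtain ⟨t₀, ht₀⟩ := hns
  refine ht₀ (hV.surjective_of_defect_eq_zero hiso (fun x => ?_) t₀)
  by_contra hx
  obtain ⟨t, ht⟩ := hcon _ hx
  refine ht (ext_inner_right ℂ fun y => ?_)
  set R := hV.resolvent with hR
  have hsym : ∀ a b, inner ℂ (R a + adjoint R a - (2 : ℝ) • R (adjoint R a)) b =
      inner ℂ a (R b + adjoint R b - (2 : ℝ) • R (adjoint R b)) := by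
    intro a b
    simp only [inner_sub_left, inner_add_left, inner_sub_right, inner_add_right,
      RCLike.real_smul_eq_coe_smul (K := ℂ), inner_smul_left, inner_smul_right,
      RCLike.conj_ofReal, adjoint_inner_left]
    simp only [← adjoint_inner_left, adjoint_adjoint]
    ring
  have h := hV.defect_comp hiso t.coe_nonneg y
  rw [Real.toNNReal_coe] at h
  rw [adjoint_inner_left, hsym, h, RCLike.real_smul_eq_coe_smul (K := ℂ), inner_smul_right,
    RCLike.real_smul_eq_coe_smul (K := ℂ) (Real.exp (-t)), inner_smul_left, hsym,
    RCLike.conj_ofReal]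

end IsContractionSemigroup

end Semigroup

/-- A continuous unimodular character of `ℝ₊` is `t ↦ e^{i t λ}`. -/
lemma exists_eq_exp_of_character (c : NNReal → ℂ) (h0 : c 0 = 1)
    (hadd : ∀ s t, c (s + t) = c s * c t) (hnorm : ∀ t, ‖c t‖ = 1) (hcont : Continuous c) :
    ∃ lam : ℝ, ∀ t : NNReal, c t = Complex.exp (Complex.I * ((t * lam : ℝ) : ℂ)) := by
  have hC : IsContractionSemigroup fun t => c t • (1 : ℂ →L[ℂ] ℂ) := by
    refine ⟨by simp [h0], fun s t => ?_, fun t x => ?_, fun x => ?_⟩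
    · ext
      simp [hadd, mul_comm]
    · simp [hnorm]
    · exact (hcont.mul (continuous_const (y := x))).congr fun t => by simp
  set r := hC.resolvent 1 with hr
  have hR : ∀ z, hC.resolvent z = z * r := fun z => by
    rw [hr, ← smul_eq_mul, ← map_smul, smul_eq_mul, mul_one]
  have hr0 : r ≠ 0 := fun h => one_ne_zero (hC.resolvent_injective (1 : ℂ) h)
  set a : ℂ := 1 - 1 / r with ha
  have hexp : ∀ t : NNReal, c t = Complex.exp (a * (t : ℝ)) := by
    intro t
    have hd : ∀ s : ℝ, 0 ≤ s → HasDerivWithinAt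
        (fun s : ℝ => Complex.exp (-(a * s)) * (c s.toNNReal * r)) 0 (Set.Ici s) s := by
      intro s hs
      have h1 := hC.hasDerivWithinAt_resolvent 1 hs
      simp only [hR, _root_.smul_apply, one_apply_eq_self, smul_eq_mul,
        mul_one] at h1
      have h2 : HasDerivAt (fun s : ℝ => Complex.exp (-(a * s)))
          (Complex.exp (-(a * s)) * -(a * 1)) s :=
        ((Complex.ofRealCLM.hasDerivAt (x := s)).const_mul a).neg.cexp
      convert! h2.hasDerivWithinAt.mul h1 using 1
      rw [ha]
      field_simp
      ring
    have hcont' : Continuous fun s : ℝ => Complex.exp (-(a * s)) * (c s.toNNReal * r) := by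
      have := hcont.comp continuous_real_toNNReal
      fun_prop
    have := constant_of_has_deriv_right_zero (b := (t : ℝ)) hcont'.continuousOn
      (fun s hs => hd s hs.1) t ⟨t.2, le_rfl⟩
    simp only [Real.toNNReal_coe, Real.toNNReal_zero, h0, Complex.ofReal_zero, mul_zero, neg_zero,
      Complex.exp_zero, ← mul_assoc] at this
    have h3 : Complex.exp (-(a * (t : ℝ))) * c t = 1 := by
      simpa using mul_right_cancel₀ hr0 this
    rw [Complex.exp_neg] at h3
    rw [eq_comm, ← inv_mul_eq_one₀ (Complex.exp_ne_zero _)]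
    exact h3
  have hre : a.re = 0 := by
    have := hnorm 1
    rw [hexp, Complex.norm_exp] at this
    simpa using this
  refine ⟨a.im, fun t => ?_⟩
  rw [hexp]
  congr 1
  apply Complex.ext <;> simp [hre]
  ring

section Cone

variable {ι : Type} [Fintype ι]

lemma measurableSet_cone (a : ι → ℝ) : MeasurableSet {x : ι → ℝ | ∀ i, a i ≤ x i} :=
  measurableSet_Ici (a := a)

/-- Translation by `t` maps the part of Lebesgue measure above `t` onto the cone measure. -/
lemma measurePreserving_sub_cone (t : ι → NNReal) :
    MeasurePreserving (fun x : ι → ℝ => x - fun i => (t i : ℝ))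
      ((coneMeasure ι).restrict {x | ∀ i, (t i : ℝ) ≤ x i}) (coneMeasure ι) := by
  have h := (measurePreserving_sub_right (volume : Measure (ι → ℝ))
    fun i => (t i : ℝ)).restrict_preimage (measurableSet_cone (0 : ι → ℝ))
  rw [coneMeasure, Measure.restrict_restrict (measurableSet_cone _)]
  convert! h using 2
  ext x
  simp only [Set.mem_inter_iff, Set.mem_ofPred_eq, Set.mem_preimage, Pi.sub_apply, Pi.zero_apply,
    sub_nonneg, and_iff_left_iff_imp]
  exact fun h i => (t i).2.trans (h i)

lemma memLp_shift (t : ι → NNReal) {f : (ι → ℝ) → ℂ} (hf : MemLp f 2 (coneMeasure ι)) :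
    MemLp (Set.indicator {x : ι → ℝ | ∀ i, (t i : ℝ) ≤ x i} fun x => f (x - fun i => (t i : ℝ))) 2
      (coneMeasure ι) :=
  (memLp_indicator_iff_restrict (measurableSet_cone _)).2
    (hf.comp_measurePreserving (measurePreserving_sub_cone t))

lemma shift_congr (t : ι → NNReal) {f g : (ι → ℝ) → ℂ} (h : f =ᵐ[coneMeasure ι] g) :
    Set.indicator {x : ι → ℝ | ∀ i, (t i : ℝ) ≤ x i} (fun x => f (x - fun i => (t i : ℝ)))
      =ᵐ[coneMeasure ι]
    Set.indicator {x : ι → ℝ | ∀ i, (t i : ℝ) ≤ x i} fun x => g (x - fun i => (t i : ℝ)) := by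
  have := (measurePreserving_sub_cone t).quasiMeasurePreserving.ae_eq_comp h
  rw [Filter.EventuallyEq, ae_restrict_iff' (measurableSet_cone _)] at this
  filter_upwards [this] with x hx
  simp only [Set.indicator]
  split_ifs with h
  exacts [hx h, rfl]

/-- The shift by `t` on `L²(ℝ₊^ι)`. -/
noncomputable def coneShift (t : ι → NNReal) :
    Lp ℂ 2 (coneMeasure ι) →ₗᵢ[ℂ] Lp ℂ 2 (coneMeasure ι) where
  toFun f := (memLp_shift t (Lp.memLp f)).toLp _
  map_add' f g := by
    rw [← MemLp.toLp_add, MemLp.toLp_eq_toLp_iff]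
    refine (shift_congr t (Lp.coeFn_add f g)).trans (.of_forall fun x => ?_)
    exact congr_fun (Set.indicator_add _ _ _) x
  map_smul' c f := by
    rw [RingHom.id_apply, ← MemLp.toLp_const_smul, MemLp.toLp_eq_toLp_iff]
    refine (shift_congr t (Lp.coeFn_smul c f)).trans (.of_forall fun x => ?_)
    simp only [Set.indicator, Pi.smul_apply, smul_ite, smul_zero]
  norm_map' f := by
    change ‖(memLp_shift t (Lp.memLp f)).toLp _‖ = _
    rw [Lp.norm_toLp, Lp.norm_def, eLpNorm_indicator_eq_eLpNorm_restrict (measurableSet_cone _)]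
    exact congr_arg _ (eLpNorm_comp_measurePreserving (Lp.aestronglyMeasurable f)
      (measurePreserving_sub_cone t))

lemma isShiftFamily_coneShift :
    IsShiftFamily ι fun t => (coneShift t).toContinuousLinearMap :=
  fun t f => (memLp_shift t (Lp.memLp f)).coeFn_toLp

lemma coneShift_toLp (t : ι → NNReal) {f : (ι → ℝ) → ℂ} (hf : MemLp f 2 (coneMeasure ι)) :
    (coneShift t (hf.toLp f) : (ι → ℝ) → ℂ) =ᵐ[coneMeasure ι]
      Set.indicator {x : ι → ℝ | ∀ i, (t i : ℝ) ≤ x i} fun x => f (x - fun i => (t i : ℝ)) :=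
  (isShiftFamily_coneShift t _).trans (shift_congr t hf.coeFn_toLp)

lemma coneShift_add (s t : ι → NNReal) (f : Lp ℂ 2 (coneMeasure ι)) :
    coneShift (s + t) f = coneShift s (coneShift t f) := by
  refine Lp.ext ?_
  refine (isShiftFamily_coneShift (s + t) f).trans (.trans ?_
    ((isShiftFamily_coneShift s _).trans (shift_congr s (isShiftFamily_coneShift t f))).symm)
  refine .of_forall fun x => ?_
  by_cases h : ∀ i, (s i : ℝ) + t i ≤ x i
  · have h1 : ∀ i, (s i : ℝ) ≤ x i := fun i => (le_add_of_nonneg_right (t i).2).trans (h i)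
    have h2 : ∀ i, (t i : ℝ) ≤ (x - fun i => (s i : ℝ)) i := fun i =>
      le_sub_iff_add_le'.2 (h i)
    rw [Set.indicator_of_mem (s := {x : ι → ℝ | ∀ i, ((s + t) i : ℝ) ≤ x i}) h,
      Set.indicator_of_mem (s := {x : ι → ℝ | ∀ i, (s i : ℝ) ≤ x i}) h1,
      Set.indicator_of_mem (s := {x : ι → ℝ | ∀ i, (t i : ℝ) ≤ x i}) h2, sub_sub]
    rfl
  · rw [Set.indicator_of_notMem (s := {x : ι → ℝ | ∀ i, ((s + t) i : ℝ) ≤ x i}) h]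
    refine (Set.indicator_apply_eq_zero.2 fun _ => Set.indicator_of_notMem (fun h2 => h ?_) _).symm
    exact fun i => le_sub_iff_add_le'.1 (h2 i)

lemma coneMeasure_eq_pi :
    coneMeasure ι = Measure.pi fun _ => (volume : Measure ℝ).restrict (Set.Ici 0) := by
  rw [← Measure.restrict_pi_pi, coneMeasure, volume_pi]
  congr 1
  ext x
  simp [Pi.le_def]

/-- The exponential `e^{-Σ xᵢ}` on the cone. -/
noncomputable def coneExp (x : ι → ℝ) : ℂ := (Real.exp (-∑ i, x i) : ℝ)

lemma coneExp_ne_zero (x : ι → ℝ) : coneExp x ≠ 0 :=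
  Complex.ofReal_ne_zero.2 (Real.exp_ne_zero _)

lemma continuous_coneExp : Continuous (coneExp : (ι → ℝ) → ℂ) := by
  unfold coneExp
  fun_prop

lemma memLp_coneExp : MemLp (coneExp : (ι → ℝ) → ℂ) 2 (coneMeasure ι) := by
  rw [memLp_two_iff_integrable_sq_norm continuous_coneExp.aestronglyMeasurable, coneMeasure_eq_pi]
  have h : ∀ x : ι → ℝ, ‖coneExp x‖ ^ 2 = ∏ i, Real.exp (-2 * x i) := fun x => by
    rw [coneExp, Complex.norm_real, Real.norm_eq_abs, Real.abs_exp, ← Real.exp_nat_mul,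
      ← Real.exp_sum, ← Finset.mul_sum]
    congr 1
    push_cast
    ring
  simp_rw [h]
  refine Integrable.fintype_prod (f := fun _ y => Real.exp (-2 * y)) fun i => ?_
  exact (integrableOn_Ici_iff_integrableOn_Ioi (by finiteness)).2
    (integrableOn_exp_mul_Ioi (by norm_num) 0)

/-- The vector `e^{-Σ xᵢ}` of `L²(ℝ₊^ι)`. -/
noncomputable def coneVacuum (ι : Type) [Fintype ι] : Lp ℂ 2 (coneMeasure ι) :=
  memLp_coneExp.toLp coneExp

/-- Gram matrix of the shifts of the exponential. -/
lemma inner_coneShift_coneVacuum (s t : ι → NNReal) :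
    inner ℂ (coneShift s (coneVacuum ι)) (coneShift t (coneVacuum ι)) =
      (Real.exp (-∑ i, |(s i : ℝ) - t i|) : ℂ) * (‖coneVacuum ι‖ ^ 2 : ℝ) := by
  set m : ι → NNReal := s ⊔ t with hm
  have h1 : inner ℂ (coneShift s (coneVacuum ι)) (coneShift t (coneVacuum ι)) =
      inner ℂ (coneShift m (coneVacuum ι))
        ((Real.exp (-∑ i, |(s i : ℝ) - t i|) : ℂ) • coneShift m (coneVacuum ι)) := by
    rw [L2.inner_def, L2.inner_def]
    refine integral_congr_ae ?_
    filter_upwards [coneShift_toLp s memLp_coneExp, coneShift_toLp t memLp_coneExp,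
      coneShift_toLp m memLp_coneExp,
      Lp.coeFn_smul (Real.exp (-∑ i, |(s i : ℝ) - t i|) : ℂ) (coneShift m (coneVacuum ι))]
      with x hs ht hm' hsm
    rw [hsm, Pi.smul_apply, coneVacuum, hs, ht, hm']
    have hmi : ∀ i, (m i : ℝ) = max (s i : ℝ) (t i) := fun i => by simp [hm]
    simp only [Set.indicator, Set.mem_ofPred_eq, hmi, sup_le_iff, forall_and]
    by_cases h : (∀ i, (s i : ℝ) ≤ x i) ∧ ∀ i, (t i : ℝ) ≤ x i
    · rw [if_pos h.1, if_pos h.2, if_pos h, RCLike.inner_apply, RCLike.inner_apply, smul_eq_mul]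
      simp only [coneExp, Complex.conj_ofReal]
      norm_cast
      rw [← Real.exp_add, ← Real.exp_add, ← Real.exp_add]
      congr 1
      simp only [← Finset.sum_neg_distrib, ← Finset.sum_add_distrib]
      refine Finset.sum_congr rfl fun i _ => ?_
      simp only [Pi.sub_apply]
      rcases le_total (s i : ℝ) (t i) with h | h
      · rw [NNReal.coe_max, abs_of_nonpos (sub_nonpos.2 h), max_eq_right h]
        ring
      · rw [NNReal.coe_max, abs_of_nonneg (sub_nonneg.2 h), max_eq_left h]
        ring
    · rw [if_neg h, smul_zero, inner_zero_right]
      rcases not_and_or.1 h with h | h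
      · rw [if_neg h, inner_zero_left]
      · rw [if_neg h, inner_zero_right]
  rw [h1, inner_smul_right, LinearIsometry.inner_map_map, inner_self_eq_norm_sq_to_K]
  push_cast
  rfl

/-- An integrable function on the cone whose integral over every translated cone vanishes is
zero almost everywhere. -/
lemma ae_eq_zero_of_setIntegral_translates {g : (ι → ℝ) → ℂ} (hg : Integrable g (coneMeasure ι))
    (h : ∀ t : ι → NNReal, ∫ x in {x | ∀ i, (t i : ℝ) ≤ x i}, g x ∂coneMeasure ι = 0) :
    g =ᵐ[coneMeasure ι] 0 := by
  have hpos : ∀ᵐ x ∂coneMeasure ι, ∀ i, 0 ≤ x i := ae_restrict_mem (measurableSet_cone 0)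
  have huniv : ∫ x, g x ∂coneMeasure ι = 0 := by
    rw [← h 0, ← setIntegral_univ]
    refine setIntegral_congr_set ?_
    filter_upwards [hpos] with x hx
    exact propext ⟨fun _ => hx, fun _ => trivial⟩
  have hspan : IsCountablySpanning (Set.range (Set.Ici : ℝ → Set ℝ)) := by
    refine ⟨fun n => Set.Ici (-(n : ℝ)), fun n => ⟨_, rfl⟩, Set.eq_univ_of_forall fun x => ?_⟩
    obtain ⟨n, hn⟩ := exists_nat_ge (-x)
    exact Set.mem_iUnion.2 ⟨n, neg_le.1 hn⟩
  have hpi : IsPiSystem (Set.range (Set.Ici : ℝ → Set ℝ)) := by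
    rintro _ ⟨a, rfl⟩ _ ⟨b, rfl⟩ _
    exact ⟨a ⊔ b, Set.Ici_inter_Ici.symm⟩
  have hgen : (inferInstance : MeasurableSpace (ι → ℝ)) = MeasurableSpace.generateFrom
      (Set.univ.pi '' Set.univ.pi fun _ : ι => Set.range (Set.Ici : ℝ → Set ℝ)) :=
    (generateFrom_eq_pi (fun _ => by
      rw [← borel_eq_generateFrom_Ici]
      exact (BorelSpace.measurable_eq (α := ℝ)).symm) fun _ => hspan).symm
  refine hg.ae_eq_zero_of_forall_setIntegral_eq_zero fun s hs _ => ?_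
  refine MeasurableSpace.induction_on_inter
    (C := fun s _ => ∫ x in s, g x ∂coneMeasure ι = 0) hgen (IsPiSystem.pi fun _ => hpi)
    (by simp) ?_ ?_ ?_ s hs
  · rintro _ ⟨u, hu, rfl⟩
    choose a ha using fun i => hu i (Set.mem_univ i)
    rw [← h fun i => (a i).toNNReal]
    refine setIntegral_congr_set ?_
    filter_upwards [hpos] with x hx
    refine propext ?_
    change x ∈ Set.univ.pi u ↔ ∀ i, ((a i).toNNReal : ℝ) ≤ x i
    simp only [Set.mem_univ_pi, ← ha, Set.mem_Ici, Real.coe_toNNReal', sup_le_iff, hx, and_true]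
  · intro t ht h0
    have := integral_add_compl ht hg
    rwa [h0, zero_add, huniv] at this
  · intro f hd hm h0
    rw [integral_iUnion hm hd hg.integrableOn]
    simp [h0]

lemma eq_zero_of_inner_coneShift (f : Lp ℂ 2 (coneMeasure ι))
    (h : ∀ t, inner ℂ (coneShift t (coneVacuum ι)) f = 0) : f = 0 := by
  have hg : Integrable (fun x => coneExp x * f x) (coneMeasure ι) :=
    memLp_coneExp.integrable_mul (Lp.memLp f)
  have hz := ae_eq_zero_of_setIntegral_translates hg fun t => by
    have h1 : inner ℂ (coneShift t (coneVacuum ι)) f = (Real.exp (∑ i, (t i : ℝ)) : ℂ) *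
        ∫ x in {x | ∀ i, (t i : ℝ) ≤ x i}, coneExp x * f x ∂coneMeasure ι := by
      rw [L2.inner_def, ← integral_const_mul, ← integral_indicator (measurableSet_cone _)]
      refine integral_congr_ae ?_
      filter_upwards [coneShift_toLp t memLp_coneExp] with x hx
      rw [coneVacuum, hx, RCLike.inner_apply]
      simp only [Set.indicator]
      split_ifs
      · rw [← mul_assoc, mul_comm]
        congr 1
        simp only [coneExp, Complex.conj_ofReal, ← Complex.ofReal_mul, ← Real.exp_add]
        congr 2
        simp only [Pi.sub_apply, Finset.sum_sub_distrib]
        ring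
      · simp
    rw [h t, eq_comm, mul_eq_zero] at h1
    exact h1.resolve_left (Complex.ofReal_ne_zero.2 (Real.exp_ne_zero _))
  refine (Lp.eq_zero_iff_ae_eq_zero).2 ?_
  filter_upwards [hz] with x hx
  exact (mul_eq_zero.1 hx).resolve_left (coneExp_ne_zero x)

lemma coneMeasure_unitCube_ne_zero :
    coneMeasure ι (Set.univ.pi fun _ => Set.Ioo (0 : ℝ) 1) ≠ 0 := by
  rw [coneMeasure, Measure.restrict_eq_self _ fun x hx i => (hx i trivial).1.le, volume_pi_pi]
  simp

lemma coneVacuum_ne_zero : coneVacuum ι ≠ 0 := by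
  intro h
  have h1 : coneExp =ᵐ[coneMeasure ι] 0 :=
    memLp_coneExp.coeFn_toLp.symm.trans (Lp.eq_zero_iff_ae_eq_zero.1 h)
  refine coneMeasure_unitCube_ne_zero (ι := ι) (measure_mono_null ?_ (ae_iff.1 h1))
  exact fun x _ => coneExp_ne_zero x

/-- A nontrivial shift is not surjective. -/
lemma not_surjective_shift {S : (ι → NNReal) →
      (Lp ℂ 2 (coneMeasure ι) →L[ℂ] Lp ℂ 2 (coneMeasure ι))} (hS : IsShiftFamily ι S)
    {t : ι → NNReal} {i : ι} (ht : 1 ≤ t i) : ¬ Function.Surjective (S t) := by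
  intro hsurj
  obtain ⟨f, hf⟩ := hsurj (coneVacuum ι)
  have h1 := hS t f
  rw [hf] at h1
  have h2 := memLp_coneExp.coeFn_toLp.symm.trans h1
  refine coneMeasure_unitCube_ne_zero (ι := ι) (measure_mono_null ?_ (ae_iff.1 h2))
  intro x hx hx'
  refine coneExp_ne_zero x (hx'.trans (Set.indicator_of_notMem (fun hmem => ?_) _))
  exact absurd ((NNReal.coe_le_coe.2 ht).trans (hmem i)) (not_le.2 (hx i trivial).2)

lemma shift_zero {S : (ι → NNReal) →
      (Lp ℂ 2 (coneMeasure ι) →L[ℂ] Lp ℂ 2 (coneMeasure ι))} (hS : IsShiftFamily ι S) :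
    S 0 = 1 := by
  ext1 f
  refine Lp.ext ((hS 0 f).trans ?_)
  have hpos : ∀ᵐ x ∂coneMeasure ι, ∀ i, 0 ≤ x i := ae_restrict_mem (measurableSet_cone 0)
  filter_upwards [hpos] with x hx
  rw [Set.indicator_of_mem (by simpa using hx)]
  congr 1
  ext
  simp

end Cone

/-- A strongly continuous doubly commuting isometric representation of the cone `ℝ₊^ι`. -/
structure IsDoublyCommuting {ι E : Type*} [DecidableEq ι] [NormedAddCommGroup E]
    [InnerProductSpace ℂ E] [CompleteSpace E] (V : (ι → NNReal) → E →L[ℂ] E) : Prop where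
  zero : V 0 = 1
  add : ∀ s t, V (s + t) = V s * V t
  norm_eq : ∀ t x, ‖V t x‖ = ‖x‖
  cont : ∀ x, Continuous fun t => V t x
  comm_adjoint : ∀ i j, i ≠ j → ∀ s t : NNReal,
    Commute (V (Pi.single i s)) (adjoint (V (Pi.single j t)))

namespace IsDoublyCommuting

variable {ι E : Type*} [DecidableEq ι] [NormedAddCommGroup E]
  [InnerProductSpace ℂ E] [CompleteSpace E] {V : (ι → NNReal) → E →L[ℂ] E}

lemma apply_add (hV : IsDoublyCommuting V) (s t : ι → NNReal) (x : E) :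
    V (s + t) x = V s (V t x) := by
  rw [hV.add, mul_apply_eq_comp]

lemma commute (hV : IsDoublyCommuting V) (s t : ι → NNReal) : Commute (V s) (V t) := by
  rw [Commute, SemiconjBy, ← hV.add, ← hV.add, add_comm]

lemma adjoint_apply_self (hV : IsDoublyCommuting V) (t : ι → NNReal) (x : E) :
    adjoint (V t) (V t x) = x :=
  congr($((ContinuousLinearMap.norm_map_iff_adjoint_comp_self (V t)).1 (hV.norm_eq t)) x)

lemma semigroup (hV : IsDoublyCommuting V) (i : ι) :
    IsContractionSemigroup fun t => V (Pi.single i t) where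
  zero := by rw [Pi.single_zero, hV.zero]
  add s t := by rw [Pi.single_add, hV.add]
  norm_le t x := (hV.norm_eq _ x).le
  cont x := (hV.cont x).comp (continuous_single (A := fun _ => NNReal) i)

lemma _root_.pi_single_induction [Fintype ι] {P : (ι → NNReal) → Prop}
    (h0 : P 0) (hadd : ∀ s t, P s → P t → P (s + t)) {t : ι → NNReal}
    (h : ∀ i, P (Pi.single i (t i))) : P t := by
  rw [← Finset.univ_sum_single t]
  exact Finset.sum_induction _ P hadd h0 fun i _ => h i

lemma commute_of_single [Fintype ι] (hV : IsDoublyCommuting V) {T : E →L[ℂ] E}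
    {t : ι → NNReal} (h : ∀ i, Commute T (V (Pi.single i (t i)))) : Commute T (V t) :=
  pi_single_induction (P := fun t => Commute T (V t)) (by rw [hV.zero]; exact Commute.one_right T)
    (fun s t hs ht => by rw [hV.add]; exact hs.mul_right ht) h

lemma commute_adjoint_of_single [Fintype ι] (hV : IsDoublyCommuting V) {T : E →L[ℂ] E}
    {t : ι → NNReal} (h : ∀ i, Commute T (adjoint (V (Pi.single i (t i))))) :
    Commute T (adjoint (V t)) := by
  rw [← commute_star_star, ← star_eq_adjoint, star_star]
  refine hV.commute_of_single fun i => ?_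
  rw [← commute_star_star, star_star]
  exact h i

lemma commute_adjoint_of_disjoint [Fintype ι] (hV : IsDoublyCommuting V) {s t : ι → NNReal}
    (h : ∀ i, s i = 0 ∨ t i = 0) : Commute (V s) (adjoint (V t)) := by
  refine hV.commute_adjoint_of_single fun j => Commute.symm (hV.commute_of_single fun i => ?_)
  rcases eq_or_ne i j with rfl | hij
  · rcases h i with h | h
    · rw [h, Pi.single_zero, hV.zero]
      exact Commute.one_right _
    · rw [h, Pi.single_zero, hV.zero, ← star_eq_adjoint, star_one]
      exact Commute.one_left _
  · exact (hV.comm_adjoint i j hij _ _).symm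

lemma adjoint_apply_apply [Fintype ι] (hV : IsDoublyCommuting V) (s t : ι → NNReal) (x : E) :
    adjoint (V s) (V t x) = V (t - s) (adjoint (V (s - t)) x) := by
  have hs : s = s ⊓ t + (s - t) := by
    ext i
    rcases le_total (s i) (t i) with h | h <;> simp [h, tsub_eq_zero_of_le]
  have ht : t = s ⊓ t + (t - s) := by
    ext i
    rcases le_total (s i) (t i) with h | h <;> simp [h, tsub_eq_zero_of_le]
  have h1 : adjoint (V s) = adjoint (V (s - t)) * adjoint (V (s ⊓ t)) := by
    conv_lhs => rw [hs, hV.add]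
    exact star_mul _ _
  have h2 : V t x = V (s ⊓ t) (V (t - s) x) := by
    conv_lhs => rw [ht, hV.apply_add]
  rw [h1, h2, mul_apply_eq_comp, hV.adjoint_apply_self]
  have h3 : Commute (V (t - s)) (adjoint (V (s - t))) := hV.commute_adjoint_of_disjoint fun i =>
    (le_total (t i) (s i)).imp tsub_eq_zero_of_le tsub_eq_zero_of_le
  exact congr($(h3.eq.symm) x)

/-- Irreducibility only needs to be tested on the one-parameter components. -/
lemma exists_eq_smul_one [Fintype ι] (hV : IsDoublyCommuting V)
    (hirr : ∀ T : E →L[ℂ] E, (∀ t, T * V t = V t * T ∧ T * adjoint (V t) = adjoint (V t) * T) →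
      ∃ c : ℂ, T = c • 1) {T : E →L[ℂ] E} (h : ∀ i t, Commute T (V (Pi.single i t)))
    (h' : ∀ i t, Commute T (adjoint (V (Pi.single i t)))) : ∃ c : ℂ, T = c • 1 :=
  hirr T fun _ => ⟨hV.commute_of_single fun i => h i _,
    hV.commute_adjoint_of_single fun i => h' i _⟩

end IsDoublyCommuting

lemma commute_starProjection {E : Type*} [NormedAddCommGroup E] [InnerProductSpace ℂ E]
    [CompleteSpace E] {M : Submodule ℂ E} [M.HasOrthogonalProjection] {T : E →L[ℂ] E}
    (h : ∀ x ∈ M, T x ∈ M) (h' : ∀ x ∈ M, adjoint T x ∈ M) : Commute M.starProjection T := by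
  ext x
  rw [mul_apply_eq_comp, mul_apply_eq_comp]
  refine (Submodule.eq_starProjection_of_mem_orthogonal
    (h _ (M.starProjection_apply_mem x)) ?_)
  rw [← map_sub, Submodule.mem_orthogonal]
  intro y hy
  rw [← adjoint_inner_left]
  exact M.sub_starProjection_mem_orthogonal x _ (h' y hy)

namespace IsDoublyCommuting

variable {ι E : Type*} [DecidableEq ι] [NormedAddCommGroup E]
  [InnerProductSpace ℂ E] [CompleteSpace E] {V : (ι → NNReal) → E →L[ℂ] E}

/-- A closed reducing subspace of an irreducible representation is trivial. -/
lemma eq_top_of_reducing [Fintype ι] (hV : IsDoublyCommuting V)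
    (hirr : ∀ T : E →L[ℂ] E, (∀ t, T * V t = V t * T ∧ T * adjoint (V t) = adjoint (V t) * T) →
      ∃ c : ℂ, T = c • 1) {M : Submodule ℂ E} (hM : IsClosed (M : Set E))
    (h : ∀ i t, ∀ x ∈ M, V (Pi.single i t) x ∈ M)
    (h' : ∀ i t, ∀ x ∈ M, adjoint (V (Pi.single i t)) x ∈ M) {x : E} (hx : x ∈ M)
    (hx0 : x ≠ 0) : M = ⊤ := by
  have : CompleteSpace M := hM.completeSpace_coe
  obtain ⟨c, hc⟩ := hV.exists_eq_smul_one hirr (T := M.starProjection)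
    (fun i t => commute_starProjection (h i t) (h' i t))
    (fun i t => commute_starProjection (h' i t) fun y hy => by
      rw [adjoint_adjoint]
      exact h i t y hy)
  have h1 : c = 1 := by
    have h2 : x = c • x := by
      conv_lhs => rw [← Submodule.starProjection_eq_self_iff.2 hx, hc]
      rfl
    exact smul_left_injective ℂ hx0 (h2.symm.trans (one_smul ℂ x).symm)
  refine eq_top_iff.2 fun y _ => ?_
  rw [← Submodule.starProjection_eq_self_iff, hc, h1, one_smul, one_apply_eq_self]

end IsDoublyCommuting

/-- The version of `exists_adjoint_eigenvector` for a reducing subspace. -/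
lemma IsContractionSemigroup.exists_adjoint_eigenvector_mem {E : Type*} [NormedAddCommGroup E]
    [InnerProductSpace ℂ E] [CompleteSpace E] {V : NNReal → E →L[ℂ] E}
    (hV : IsContractionSemigroup V) (hiso : ∀ t x, ‖V t x‖ = ‖x‖) {K : Submodule ℂ E}
    (hK : IsClosed (K : Set E)) (h : ∀ t, ∀ x ∈ K, V t x ∈ K)
    (h' : ∀ t, ∀ x ∈ K, adjoint (V t) x ∈ K) {y : E} (hy : y ∈ K) {t₀ : NNReal}
    (hns : V t₀ (adjoint (V t₀) y) ≠ y) :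
    ∃ ξ ∈ K, ξ ≠ 0 ∧ ∀ t, adjoint (V t) ξ = Real.exp (-t) • ξ := by
  have : CompleteSpace K := hK.completeSpace_coe
  let W : NNReal → K →L[ℂ] K := fun t => (V t).restrict (h t)
  have hW : IsContractionSemigroup W :=
    { zero := by
        ext x
        exact congr($hV.zero x)
      add := fun s t => by
        ext x
        exact congr($(hV.add s t) x)
      norm_le := fun t x => hV.norm_le t x
      cont := fun x => (hV.cont x).subtype_mk _ }
  have hadj : ∀ t (x : K), (adjoint (W t) x : E) = adjoint (V t) x := fun t x => by
    have h1 : adjoint (W t) x = ⟨adjoint (V t) x, h' t x x.2⟩ := ext_inner_left ℂ fun z => by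
      rw [adjoint_inner_right, Submodule.coe_inner, Submodule.coe_inner, adjoint_inner_right]
      rfl
    rw [h1]
  obtain ⟨ξ, hξ, hξ'⟩ := hW.exists_adjoint_eigenvector (fun t x => hiso t x) ⟨t₀, fun hs => by
    obtain ⟨x, hx⟩ := hs ⟨y, hy⟩
    have hx' : V t₀ x = y := congr($hx)
    rw [← hx', adjoint_comp_self hiso] at hns
    exact hns rfl⟩
  refine ⟨ξ, ξ.2, fun h0 => hξ (Subtype.ext h0), fun t => ?_⟩
  rw [← hadj, hξ']
  rfl

namespace IsDoublyCommuting

variable {ι E : Type*} [DecidableEq ι] [NormedAddCommGroup E]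
  [InnerProductSpace ℂ E] [CompleteSpace E] {V : (ι → NNReal) → E →L[ℂ] E}

lemma adjoint_commute (hV : IsDoublyCommuting V) (s t : ι → NNReal) :
    Commute (adjoint (V s)) (adjoint (V t)) :=
  commute_star_star.2 (hV.commute s t)

/-- The components of an irreducible representation are either unitary or completely
nonunitary. -/
lemma surjective_of_apply_adjoint_eq [Fintype ι] (hV : IsDoublyCommuting V)
    (hirr : ∀ T : E →L[ℂ] E, (∀ t, T * V t = V t * T ∧ T * adjoint (V t) = adjoint (V t) * T) →
      ∃ c : ℂ, T = c • 1) {i : ι} {x : E} (hx0 : x ≠ 0)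
    (hx : ∀ t, V (Pi.single i t) (adjoint (V (Pi.single i t)) x) = x) (t : NNReal) :
    Function.Surjective (V (Pi.single i t)) := by
  let M : Submodule ℂ E :=
    { carrier := {x | ∀ t, V (Pi.single i t) (adjoint (V (Pi.single i t)) x) = x}
      add_mem' := fun hx hy t => by rw [map_add, map_add, hx, hy]
      zero_mem' := fun t => by rw [map_zero, map_zero]
      smul_mem' := fun c x hx t => by rw [map_smul, map_smul, hx] }
  have hM : IsClosed (M : Set E) := by
    change IsClosed {x | ∀ t, V (Pi.single i t) (adjoint (V (Pi.single i t)) x) = x}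
    rw [Set.ofPred_forall]
    exact isClosed_iInter fun t => isClosed_eq (by fun_prop) continuous_id
  have hmem : ∀ x, (∀ t, ∃ y, V (Pi.single i t) y = x) → x ∈ M := fun x hx t => by
    obtain ⟨y, rfl⟩ := hx t
    rw [hV.adjoint_apply_self]
  have htop : M = ⊤ := by
    refine hV.eq_top_of_reducing hirr hM (fun j s x hx => hmem _ fun t => ?_)
      (fun j s x hx => hmem _ fun t => ?_) hx hx0
    · refine ⟨V (Pi.single j s) (adjoint (V (Pi.single i t)) x), ?_⟩
      rw [← hV.apply_add, add_comm, hV.apply_add, hx t]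
    · rcases eq_or_ne i j with rfl | hij
      · refine ⟨adjoint (V (Pi.single i (s + t))) x, ?_⟩
        conv_rhs => rw [← hx (s + t), Pi.single_add, hV.apply_add, hV.adjoint_apply_self]
        rw [Pi.single_add]
      · refine ⟨adjoint (V (Pi.single j s)) (adjoint (V (Pi.single i t)) x), ?_⟩
        conv_rhs => rw [← hx t]
        exact congr($((hV.comm_adjoint i j hij t s).eq) (adjoint (V (Pi.single i t)) x))
  exact fun y => ⟨_, (htop ▸ Submodule.mem_top : y ∈ M) t⟩

lemma exists_joint_eigenvector [Fintype ι] [Nontrivial E] (hV : IsDoublyCommuting V)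
    (hirr : ∀ T : E →L[ℂ] E, (∀ t, T * V t = V t * T ∧ T * adjoint (V t) = adjoint (V t) * T) →
      ∃ c : ℂ, T = c • 1) (A : Finset ι)
    (hA : ∀ i ∈ A, ∃ t, ¬ Function.Surjective (V (Pi.single i t))) :
    ∃ x : E, x ≠ 0 ∧ ∀ i ∈ A, ∀ t : NNReal,
      adjoint (V (Pi.single i t)) x = Real.exp (-t) • x := by
  induction A using Finset.induction_on with
  | empty =>
    obtain ⟨x, hx⟩ := exists_ne (0 : E)
    exact ⟨x, hx, by simp⟩
  | insert j B hj ih =>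
    obtain ⟨x, hx0, hx⟩ := ih fun i hi => hA i (Finset.mem_insert_of_mem hi)
    let K : Submodule ℂ E :=
      { carrier := {x | ∀ i ∈ B, ∀ t : NNReal,
          adjoint (V (Pi.single i t)) x = Real.exp (-t) • x}
        add_mem' := fun hx hy i hi t => by rw [map_add, hx i hi, hy i hi, smul_add]
        zero_mem' := fun i _ t => by rw [map_zero, smul_zero]
        smul_mem' := fun c x hx i hi t => by rw [map_smul, hx i hi, smul_comm] }
    have hK : IsClosed (K : Set E) := by
      change IsClosed {x | ∀ i ∈ B, ∀ t : NNReal,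
          adjoint (V (Pi.single i t)) x = Real.exp (-t) • x}
      simp only [Set.ofPred_forall]
      exact isClosed_biInter fun i _ => isClosed_iInter fun t =>
        isClosed_eq (by fun_prop) (by fun_prop)
    obtain ⟨t₀, ht₀⟩ : ∃ t, V (Pi.single j t) (adjoint (V (Pi.single j t)) x) ≠ x := by
      by_contra! h
      obtain ⟨t, ht⟩ := hA j (Finset.mem_insert_self j B)
      exact ht (hV.surjective_of_apply_adjoint_eq hirr hx0 h t)
    obtain ⟨ξ, hξK, hξ0, hξ⟩ := (hV.semigroup j).exists_adjoint_eigenvector_mem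
      (fun t => hV.norm_eq _) hK
      (fun t y hy i hi s => by
        have hji : j ≠ i := fun h => hj (h ▸ hi)
        rw [← (V (Pi.single j t)).map_smul_of_tower, ← hy i hi s]
        exact congr($((hV.comm_adjoint j i hji t s).eq.symm) y))
      (fun t y hy i hi s => by
        rw [← (adjoint (V (Pi.single j t))).map_smul_of_tower, ← hy i hi s]
        exact congr($((hV.adjoint_commute (Pi.single i s) (Pi.single j t)).eq) y))
      (y := x) hx ht₀
    refine ⟨ξ, hξ0, fun i hi => ?_⟩
    rcases Finset.mem_insert.1 hi with rfl | hi
    · exact hξ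
    · exact hξK i hi

lemma adjoint_apply_eigenvector [Fintype ι] (hV : IsDoublyCommuting V) {x : E} {t : ι → NNReal}
    (h : ∀ i, adjoint (V (Pi.single i (t i))) x = Real.exp (-t i) • x) :
    adjoint (V t) x = Real.exp (-∑ i, (t i : ℝ)) • x := by
  refine pi_single_induction (P := fun t => adjoint (V t) x = Real.exp (-∑ i, (t i : ℝ)) • x)
    ?_ ?_ fun i => ?_
  · simp [hV.zero, ← star_eq_adjoint]
  · intro s t hs ht
    have h1 : adjoint (V (s + t)) x = adjoint (V t) (adjoint (V s) x) := by
      rw [hV.add, ← star_eq_adjoint, star_mul]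
      rfl
    rw [h1, hs, (adjoint (V t)).map_smul_of_tower, ht, smul_smul, ← Real.exp_add]
    congr 2
    simp only [Pi.add_apply, NNReal.coe_add, Finset.sum_add_distrib]
    ring
  · rw [h]
    congr 3
    simp [Pi.single_apply, apply_ite]

lemma inner_apply_eigenvector [Fintype ι] (hV : IsDoublyCommuting V) {x : E} {A : Finset ι}
    (h : ∀ i ∈ A, ∀ t : NNReal, adjoint (V (Pi.single i t)) x = Real.exp (-t) • x)
    {s t : ι → NNReal} (hs : ∀ i ∉ A, s i = 0) (ht : ∀ i ∉ A, t i = 0) :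
    inner ℂ (V s x) (V t x) =
      (Real.exp (-∑ i, |(s i : ℝ) - t i|) : ℂ) * (‖x‖ ^ 2 : ℝ) := by
  have h1 : ∀ r : ι → NNReal, (∀ i ∉ A, r i = 0) →
      adjoint (V r) x = Real.exp (-∑ i, (r i : ℝ)) • x := fun r hr =>
    hV.adjoint_apply_eigenvector fun i => by
      by_cases hi : i ∈ A
      · exact h i hi _
      · simp [hr i hi, hV.zero, ← star_eq_adjoint]
  rw [← adjoint_inner_right, hV.adjoint_apply_apply, h1 (s - t) fun i hi => by simp [hs i hi],
    (V (t - s)).map_smul_of_tower, RCLike.real_smul_eq_coe_smul (K := ℂ), inner_smul_right,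
    ← adjoint_inner_left, h1 (t - s) fun i hi => by simp [ht i hi],
    RCLike.real_smul_eq_coe_smul (K := ℂ), inner_smul_left, inner_self_eq_norm_sq_to_K,
    RCLike.conj_ofReal, RCLike.ofReal_eq_complex_ofReal]
  rw [Complex.ofReal_pow, ← mul_assoc, ← Complex.ofReal_mul, ← Real.exp_add, ← neg_add,
    ← Finset.sum_add_distrib]
  congr 4
  refine Finset.sum_congr rfl fun i _ => ?_
  rcases le_total (s i) (t i) with h | h
  · rw [abs_of_nonpos (sub_nonpos.2 (NNReal.coe_le_coe.2 h))]
    simp [tsub_eq_zero_of_le h, NNReal.coe_sub h]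
  · rw [abs_of_nonneg (sub_nonneg.2 (NNReal.coe_le_coe.2 h))]
    simp [tsub_eq_zero_of_le h, NNReal.coe_sub h]

/-- A joint eigenvector of the adjoints is cyclic for the representation. -/
lemma span_orbit_dense [Fintype ι] (hV : IsDoublyCommuting V)
    (hirr : ∀ T : E →L[ℂ] E, (∀ t, T * V t = V t * T ∧ T * adjoint (V t) = adjoint (V t) * T) →
      ∃ c : ℂ, T = c • 1) {x : E} (hx0 : x ≠ 0)
    (hx : ∀ i t, ∃ c : ℂ, adjoint (V (Pi.single i t)) x = c • x) :
    (Submodule.span ℂ (Set.range fun t => V t x)).topologicalClosure = ⊤ := by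
  set N := Submodule.span ℂ (Set.range fun t => V t x)
  have hinv : ∀ T : E →L[ℂ] E, (∀ t, T (V t x) ∈ N) →
      ∀ y ∈ N.topologicalClosure, T y ∈ N.topologicalClosure := fun T hT y hy => by
    refine map_mem_closure T.continuous hy fun z hz => ?_
    have : N ≤ N.comap T.toLinearMap := Submodule.span_le.2 <| by
      rintro _ ⟨t, rfl⟩
      exact hT t
    exact this hz
  have hmem : ∀ t, V t x ∈ N := fun t => Submodule.subset_span ⟨t, rfl⟩
  refine hV.eq_top_of_reducing hirr N.isClosed_topologicalClosure
    (fun i s => hinv _ fun t => ?_) (fun i s => hinv _ fun t => ?_)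
    (N.le_topologicalClosure (hmem 0)) (x := V 0 x) (by rwa [hV.zero])
  · rw [← hV.apply_add]
    exact hmem _
  · have h1 : Pi.single i s - t = Pi.single i (s - t i) := by
      ext j
      rcases eq_or_ne j i with rfl | hj
      · simp
      · simp [hj]
    obtain ⟨c, hc⟩ := hx i (s - t i)
    rw [hV.adjoint_apply_apply, h1, hc, map_smul]
    exact N.smul_mem c (hmem _)

end IsDoublyCommuting

lemma denseRange_linearCombination {α E : Type*} [NormedAddCommGroup E] [NormedSpace ℂ E]
    {v : α → E} (hv : (Submodule.span ℂ (Set.range v)).topologicalClosure = ⊤) :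
    DenseRange (Finsupp.linearCombination ℂ v) := by
  rw [DenseRange, ← LinearMap.coe_range, Finsupp.range_linearCombination]
  exact Submodule.dense_iff_topologicalClosure_eq_top.2 hv

/-- Two total families with the same Gram matrix are unitarily equivalent. -/
lemma exists_linearIsometryEquiv_of_inner_eq {α E F : Type*} [NormedAddCommGroup E]
    [InnerProductSpace ℂ E] [CompleteSpace E] [NormedAddCommGroup F] [InnerProductSpace ℂ F]
    [CompleteSpace F] {u : α → E} {w : α → F}
    (hu : (Submodule.span ℂ (Set.range u)).topologicalClosure = ⊤)
    (hw : (Submodule.span ℂ (Set.range w)).topologicalClosure = ⊤)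
    (h : ∀ a b, inner ℂ (u a) (u b) = inner ℂ (w a) (w b)) :
    ∃ U : E ≃ₗᵢ[ℂ] F, ∀ a, U (u a) = w a := by
  have hnorm : ∀ x : α →₀ ℂ, ‖Finsupp.linearCombination ℂ w (LinearEquiv.refl ℂ _ x)‖ =
      ‖Finsupp.linearCombination ℂ u x‖ := fun x => by
    rw [LinearEquiv.refl_apply, @norm_eq_sqrt_re_inner ℂ, @norm_eq_sqrt_re_inner ℂ]
    simp only [Finsupp.linearCombination_apply, Finsupp.sum, sum_inner, inner_sum,
      inner_smul_left, inner_smul_right, h]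
  refine ⟨(LinearEquiv.refl ℂ (α →₀ ℂ)).extendOfIsometry _ _ (denseRange_linearCombination hu)
    (denseRange_linearCombination hw) hnorm,
    fun a => ?_⟩
  have := LinearEquiv.extendOfIsometry_eq (LinearEquiv.refl ℂ (α →₀ ℂ)) _ _
    (denseRange_linearCombination hu) (denseRange_linearCombination hw) hnorm (Finsupp.single a 1)
  simpa using this

namespace IsDoublyCommuting

variable {ι E : Type*} [DecidableEq ι] [Fintype ι] [NormedAddCommGroup E]
  [InnerProductSpace ℂ E] [CompleteSpace E] {V : (ι → NNReal) → E →L[ℂ] E}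

/-- A unitary component of an irreducible representation is a character. -/
lemma exists_frequency [Nontrivial E] (hV : IsDoublyCommuting V)
    (hirr : ∀ T : E →L[ℂ] E, (∀ t, T * V t = V t * T ∧ T * adjoint (V t) = adjoint (V t) * T) →
      ∃ c : ℂ, T = c • 1) {i : ι} (hs : ∀ t, Function.Surjective (V (Pi.single i t))) :
    ∃ lam : ℝ, ∀ (t : NNReal) (x : E),
      V (Pi.single i t) x = Complex.exp (Complex.I * ((t * lam : ℝ) : ℂ)) • x := by
  have hscalar : ∀ t, ∃ c : ℂ, V (Pi.single i t) = c • 1 := fun t => by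
    refine hV.exists_eq_smul_one hirr (fun j s => hV.commute _ _) fun j s => ?_
    rcases eq_or_ne i j with rfl | hij
    · ext x
      obtain ⟨y, rfl⟩ := hs s x
      rw [mul_apply_eq_comp, mul_apply_eq_comp, hV.adjoint_apply_self, ← hV.apply_add,
        add_comm, hV.apply_add, hV.adjoint_apply_self]
    · exact hV.comm_adjoint i j hij t s
  choose c hc using hscalar
  have hc' : ∀ t x, V (Pi.single i t) x = c t • x := fun t x => by
    rw [hc]
    rfl
  obtain ⟨x, hx⟩ := exists_ne (0 : E)
  have hinj := smul_left_injective ℂ hx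
  have hnx : ‖x‖ ≠ 0 := norm_ne_zero_iff.2 hx
  obtain ⟨lam, hlam⟩ := exists_eq_exp_of_character c
    (hinj (by simp only [← hc', Pi.single_zero, hV.zero, one_smul, one_apply_eq_self]))
    (fun s t => hinj (by simp only [← hc', Pi.single_add, hV.apply_add, mul_smul]))
    (fun t => mul_right_cancel₀ hnx (by rw [← norm_smul, ← hc', hV.norm_eq, one_mul]))
    (by
      have h1 : c = fun t => inner ℂ x (V (Pi.single i t) x) / (‖x‖ : ℂ) ^ 2 := by
        ext t
        rw [hc', inner_smul_right, inner_self_eq_norm_sq_to_K]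
        exact (mul_div_cancel_right₀ _ (pow_ne_zero 2 (Complex.ofReal_ne_zero.2 hnx))).symm
      rw [h1]
      exact (continuous_const.inner ((hV.semigroup i).cont x)).div_const _)
  exact ⟨lam, fun t x => by rw [hc', hlam]⟩

lemma apply_of_frequency (hV : IsDoublyCommuting V) {A : Finset ι} {lam : ι → ℝ}
    (h : ∀ i ∉ A, ∀ (t : NNReal) (x : E),
      V (Pi.single i t) x = Complex.exp (Complex.I * ((t * lam i : ℝ) : ℂ)) • x)
    {t : ι → NNReal} (ht : ∀ i ∈ A, t i = 0) (x : E) :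
    V t x = Complex.exp (Complex.I * ((∑ j ∈ Aᶜ, (t j : ℝ) * lam j : ℝ) : ℂ)) • x := by
  refine pi_single_induction (P := fun t : ι → NNReal => ∀ x, V t x =
    Complex.exp (Complex.I * ((∑ j ∈ Aᶜ, (t j : ℝ) * lam j : ℝ) : ℂ)) • x) ?_ ?_ (fun i => ?_) x
  · simp [hV.zero]
  · intro s t hs ht x
    rw [hV.apply_add, ht, hs, smul_smul, ← Complex.exp_add, ← mul_add, ← Complex.ofReal_add,
      ← Finset.sum_add_distrib]
    simp only [Pi.add_apply, NNReal.coe_add, add_mul]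
  · intro x
    by_cases hi : i ∈ A
    · simp [ht i hi, hV.zero]
    · rw [h i hi, Finset.sum_eq_single_of_mem i (Finset.mem_compl.2 hi) fun j _ hj => by
        simp [hj]]
      simp

end IsDoublyCommuting

/-- Extension by zero of a point of `ℝ₊^A` to a point of `ℝ₊^ι`. -/
def extendZero {ι : Type} [DecidableEq ι] (A : Finset ι) (a : {i // i ∈ A} → NNReal) :
    ι → NNReal :=
  fun i => if h : i ∈ A then a ⟨i, h⟩ else 0

section extendZero

variable {ι : Type} [DecidableEq ι] {A : Finset ι}

@[simp]
lemma extendZero_coe (a : {i // i ∈ A} → NNReal) (i : {i // i ∈ A}) :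
    extendZero A a i = a i :=
  dif_pos i.2

lemma extendZero_of_notMem (a : {i // i ∈ A} → NNReal) {i : ι} (hi : i ∉ A) :
    extendZero A a i = 0 :=
  dif_neg hi

lemma extendZero_add (a b : {i // i ∈ A} → NNReal) :
    extendZero A (a + b) = extendZero A a + extendZero A b := by
  ext i
  by_cases hi : i ∈ A <;> simp [extendZero, hi]

lemma sum_abs_extendZero_sub [Fintype ι] (a b : {i // i ∈ A} → NNReal) :
    ∑ i, |(extendZero A a i : ℝ) - extendZero A b i| = ∑ i, |(a i : ℝ) - b i| := by
  rw [← Finset.sum_subset A.subset_univ fun i _ hi => by simp [extendZero_of_notMem _ hi],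
    ← Finset.sum_coe_sort]
  simp

lemma IsDoublyCommuting.apply_eq_smul_extendZero [Fintype ι] {E : Type*} [NormedAddCommGroup E]
    [InnerProductSpace ℂ E] [CompleteSpace E] {V : (ι → NNReal) → E →L[ℂ] E}
    (hV : IsDoublyCommuting V) {lam : ι → ℝ}
    (h : ∀ i ∉ A, ∀ (t : NNReal) (x : E),
      V (Pi.single i t) x = Complex.exp (Complex.I * ((t * lam i : ℝ) : ℂ)) • x)
    (t : ι → NNReal) (x : E) :
    V t x = Complex.exp (Complex.I * ((∑ j ∈ Aᶜ, (t j : ℝ) * lam j : ℝ) : ℂ)) •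
      V (extendZero A fun i => t i) x := by
  have ht : t = (fun i => if i ∈ A then 0 else t i) + extendZero A fun i => t i := by
    ext i
    by_cases hi : i ∈ A <;> simp [extendZero, hi]
  conv_lhs => rw [ht, hV.apply_add, hV.apply_of_frequency h fun i hi => if_pos hi]
  congr 4
  refine Finset.sum_congr rfl fun i hi => ?_
  rw [if_neg (Finset.mem_compl.1 hi)]

end extendZero

/-- A representation whose components outside `A` are characters and whose components in `A` have
a joint eigenvector for the adjoints is classified by `A`. -/
lemma IsDoublyCommuting.classifiedBy {d : ℕ} {H : Type*} [NormedAddCommGroup H]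
    [InnerProductSpace ℂ H] [CompleteSpace H] {V : (Fin d → NNReal) → H →L[ℂ] H}
    (hV : IsDoublyCommuting V)
    (hirr : ∀ T : H →L[ℂ] H, (∀ t, T * V t = V t * T ∧ T * adjoint (V t) = adjoint (V t) * T) →
      ∃ c : ℂ, T = c • 1) {A : Finset (Fin d)} {lam : Fin d → ℝ}
    (h : ∀ i ∉ A, ∀ (t : NNReal) (x : H),
      V (Pi.single i t) x = Complex.exp (Complex.I * ((t * lam i : ℝ) : ℂ)) • x)
    {x : H} (hx0 : x ≠ 0)
    (hx : ∀ i ∈ A, ∀ t : NNReal, adjoint (V (Pi.single i t)) x = Real.exp (-t) • x) :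
    ClassifiedBy H V A lam := by
  wlog hnorm : ‖x‖ = ‖coneVacuum {i // i ∈ A}‖ generalizing x
  · have hx1 : (‖x‖ : ℂ) ≠ 0 := Complex.ofReal_ne_zero.2 (norm_ne_zero_iff.2 hx0)
    have hv : (‖coneVacuum {i // i ∈ A}‖ : ℂ) ≠ 0 :=
      Complex.ofReal_ne_zero.2 (norm_ne_zero_iff.2 coneVacuum_ne_zero)
    refine this (x := ((‖coneVacuum {i // i ∈ A}‖ : ℂ) / ‖x‖) • x)
      (smul_ne_zero (div_ne_zero hv hx1) hx0) (fun i hi t => ?_) ?_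
    · rw [map_smul, hx i hi, smul_comm]
    · rw [norm_smul, norm_div, Complex.norm_real, Complex.norm_real, norm_norm, norm_norm,
        div_mul_cancel₀ _ (norm_ne_zero_iff.2 hx0)]
  have hu : (Submodule.span ℂ (Set.range fun a => V (extendZero A a) x)).topologicalClosure = ⊤ :=
    by
    refine top_unique ((hV.span_orbit_dense hirr hx0 fun i t => ?_).ge.trans
      (Submodule.topologicalClosure_mono (Submodule.span_le.2 ?_)))
    · by_cases hi : i ∈ A
      · exact ⟨_, (hx i hi t).trans (RCLike.real_smul_eq_coe_smul (K := ℂ) _ _)⟩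
      · refine ⟨(Complex.exp (Complex.I * ((t * lam i : ℝ) : ℂ)))⁻¹, ?_⟩
        rw [eq_inv_smul_iff₀ (Complex.exp_ne_zero _), ← map_smul, ← h i hi,
          hV.adjoint_apply_self]
    · rintro _ ⟨t, rfl⟩
      simp only
      rw [hV.apply_eq_smul_extendZero h]
      exact Submodule.smul_mem _ _ (Submodule.subset_span ⟨_, rfl⟩)
  have hw : (Submodule.span ℂ (Set.range fun a =>
      coneShift a (coneVacuum {i // i ∈ A}))).topologicalClosure = ⊤ := by
    rw [Submodule.topologicalClosure_eq_top_iff, Submodule.eq_bot_iff]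
    exact fun f hf => eq_zero_of_inner_coneShift f fun t => hf _ (Submodule.subset_span ⟨t, rfl⟩)
  obtain ⟨U, hU⟩ := exists_linearIsometryEquiv_of_inner_eq hu hw fun a b => by
    rw [hV.inner_apply_eigenvector hx (fun i hi => extendZero_of_notMem a hi)
      (fun i hi => extendZero_of_notMem b hi), sum_abs_extendZero_sub,
      inner_coneShift_coneVacuum, hnorm]
  refine ⟨U, _, isShiftFamily_coneShift, fun t ξ => ?_⟩
  have key : U.toContinuousLinearEquiv.toContinuousLinearMap.comp (V t) =
      Complex.exp (Complex.I * ((∑ j ∈ Aᶜ, (t j : ℝ) * lam j : ℝ) : ℂ)) •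
        (coneShift fun i => t i.1).toContinuousLinearMap.comp
          U.toContinuousLinearEquiv.toContinuousLinearMap := by
    refine ContinuousLinearMap.ext_on (Submodule.dense_iff_topologicalClosure_eq_top.2 hu) ?_
    rintro _ ⟨a, rfl⟩
    change U (V t (V (extendZero A a) x)) = (_ : ℂ) • coneShift _ (U (V (extendZero A a) x))
    rw [hV.apply_eq_smul_extendZero h, map_smul, ← hV.apply_add, ← extendZero_add, hU, hU,
      coneShift_add]
  exact congr($key ξ)

section Uniqueness

variable {d : ℕ} {H : Type*} [NormedAddCommGroup H] [InnerProductSpace ℂ H]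
  {V : (Fin d → NNReal) → H →L[ℂ] H} {A : Finset (Fin d)} {lam : Fin d → ℝ}

lemma ClassifiedBy.apply_single_of_notMem (h : ClassifiedBy H V A lam) {i : Fin d} (hi : i ∉ A)
    (t : NNReal) (x : H) :
    V (Pi.single i t) x = Complex.exp (Complex.I * ((t * lam i : ℝ) : ℂ)) • x := by
  obtain ⟨U, S, hS, hU⟩ := h
  refine U.injective ?_
  have h0 : (fun j : {j // j ∈ A} => (Pi.single i t : Fin d → NNReal) j.1) = 0 := by
    ext j
    have : j.1 ≠ i := fun h => hi (h ▸ j.2)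
    simp [this]
  rw [hU, h0, shift_zero hS, map_smul, one_apply_eq_self,
    Finset.sum_eq_single_of_mem i (Finset.mem_compl.2 hi) fun j _ hj => by simp [hj]]
  simp

lemma ClassifiedBy.not_surjective_single (h : ClassifiedBy H V A lam) {i : Fin d} (hi : i ∈ A) :
    ¬ Function.Surjective (V (Pi.single i 1)) := by
  obtain ⟨U, S, hS, hU⟩ := h
  intro hsurj
  refine not_surjective_shift hS (t := fun j => (Pi.single i 1 : Fin d → NNReal) j.1)
    (i := ⟨i, hi⟩) (by simp) fun f => ?_
  set c := Complex.exp (Complex.I * ((∑ j ∈ Aᶜ, ((Pi.single i 1 : Fin d → NNReal) j : ℝ) *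
    lam j : ℝ) : ℂ))
  obtain ⟨x, hx⟩ := hsurj (U.symm (c • f))
  refine ⟨U x, smul_right_injective _ (Complex.exp_ne_zero _ : c ≠ 0) ?_⟩
  simp only
  rw [← hU, hx, U.apply_symm_apply]

/-- The set of nonunitary components is determined by the representation. -/
lemma ClassifiedBy.mem_iff (h : ClassifiedBy H V A lam) (i : Fin d) :
    i ∈ A ↔ ¬ Function.Surjective (V (Pi.single i 1)) := by
  refine ⟨h.not_surjective_single, fun hs => ?_⟩
  by_contra hi
  refine hs fun y => ⟨(Complex.exp (Complex.I * (((1 : NNReal) * lam i : ℝ) : ℂ)))⁻¹ • y, ?_⟩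
  rw [h.apply_single_of_notMem hi, smul_inv_smul₀ (Complex.exp_ne_zero _)]

end Uniqueness

lemma eq_of_exp_eq {a b : ℝ} (h : ∀ t : NNReal, Complex.exp (Complex.I * ((t * a : ℝ) : ℂ)) =
    Complex.exp (Complex.I * ((t * b : ℝ) : ℂ))) : a = b := by
  by_contra hab
  have hpos : 0 < |a - b| := abs_pos.2 (sub_ne_zero.2 hab)
  obtain ⟨n, hn⟩ := Complex.exp_eq_exp_iff_exists_int.1 (h (Real.toNNReal (Real.pi / |a - b|)))
  rw [Real.coe_toNNReal _ (by positivity)] at hn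
  have h1 : Real.pi / |a - b| * a = Real.pi / |a - b| * b + n * (2 * Real.pi) := by
    have h2 : Complex.I * ((Real.pi / |a - b| * a : ℝ) : ℂ) =
        Complex.I * ((Real.pi / |a - b| * b + n * (2 * Real.pi) : ℝ) : ℂ) := by
      rw [hn]
      push_cast
      ring
    exact_mod_cast mul_left_cancel₀ Complex.I_ne_zero h2
  have h3 : (a - b) = n * 2 * |a - b| := by
    field_simp at h1
    linarith
  have h4 : |(n : ℝ) * 2| = 1 := by
    have := congr(|$h3|)
    rw [abs_mul, abs_abs] at this
    exact (mul_right_cancel₀ hpos.ne' ((one_mul _).trans this)).symm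
  have h5 : |n * 2| = 1 := by exact_mod_cast h4
  rcases abs_eq zero_le_one |>.1 h5 with h | h <;> omega

/-- classification of irreducible doubly commuting representations: a strongly
continuous, doubly commuting, irreducible isometric representation of `ℝ₊^d` on a nonzero
separable Hilbert space is, for a unique `A ⊆ {1,…,d}` and a unique `λ` on the complement of
`A`, unitarily equivalent to `t ↦ e^{i Σ_{j ∉ A} t_j λ_j} S_{t|_A}` on `L²(ℝ₊^A)`. -/
theorem stmt_12 (d : ℕ) (hd : 1 ≤ d)
    (H : Type*) [NormedAddCommGroup H] [InnerProductSpace ℂ H] [CompleteSpace H]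
    [TopologicalSpace.SeparableSpace H] [Nontrivial H]
    (V : (Fin d → NNReal) → H →L[ℂ] H)
    (hV0 : V 0 = 1)
    (hVadd : ∀ s t : Fin d → NNReal, V (s + t) = V s * V t)
    (hiso : ∀ (t : Fin d → NNReal) (x : H), ‖V t x‖ = ‖x‖)
    (hcont : ∀ ξ : H, Continuous fun t : Fin d → NNReal => V t ξ)
    (hdc : ∀ i j : Fin d, i ≠ j → ∀ s t : NNReal,
      V (Pi.single i s) * adjoint (V (Pi.single j t))
        = adjoint (V (Pi.single j t)) * V (Pi.single i s))
    (hirr : ∀ T : H →L[ℂ] H,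
      (∀ t : Fin d → NNReal, T * V t = V t * T ∧ T * adjoint (V t) = adjoint (V t) * T) →
      ∃ c : ℂ, T = c • 1) :
    ∃ (A : Finset (Fin d)) (lam : Fin d → ℝ),
      ClassifiedBy H V A lam ∧
      ∀ (A' : Finset (Fin d)) (lam' : Fin d → ℝ),
        ClassifiedBy H V A' lam' → A' = A ∧ ∀ i ∉ A', lam' i = lam i := by
  classical
  have hV : IsDoublyCommuting V := ⟨hV0, hVadd, hiso, hcont, hdc⟩
  let A : Finset (Fin d) := {i | ∃ t, ¬ Function.Surjective (V (Pi.single i t))}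
  have hA : ∀ i, i ∈ A ↔ ∃ t, ¬ Function.Surjective (V (Pi.single i t)) := fun i => by simp [A]
  have hfreq : ∀ i, ∃ lam : ℝ, i ∉ A → ∀ (t : NNReal) (x : H),
      V (Pi.single i t) x = Complex.exp (Complex.I * ((t * lam : ℝ) : ℂ)) • x := fun i => by
    by_cases hi : i ∈ A
    · exact ⟨0, fun h => absurd hi h⟩
    · obtain ⟨lam, hlam⟩ := hV.exists_frequency hirr (i := i) (by simpa [hA] using hi)
      exact ⟨lam, fun _ => hlam⟩
  choose lam hlam using hfreq
  obtain ⟨x, hx0, hx⟩ := hV.exists_joint_eigenvector hirr A fun i hi => (hA i).1 hi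
  have hcl := hV.classifiedBy hirr hlam hx0 hx
  refine ⟨A, lam, hcl, fun A' lam' h' => ?_⟩
  obtain rfl : A' = A := Finset.ext fun i => (h'.mem_iff i).trans (hcl.mem_iff i).symm
  refine ⟨rfl, fun i hi => eq_of_exp_eq fun t => smul_left_injective ℂ hx0 ?_⟩
  exact (h'.apply_single_of_notMem hi t x).symm.trans (hcl.apply_single_of_notMem hi t x)
end

section
/- Let K be an infinite-dimensional separable complex Hilbert space and let S̃ = (S̃_t)_{t≥0} be the K-valued shift semigroup on L²(ℝ₊; K): (S̃_t f)(x) = f(x−t) if x ≥ t and (S̃_t f)(x) = 0 otherwise (Lebesgue-a.e. x). Then for every λ ∈ ℝ, every ε > 0, every a > 0, and every finite set F of unit vectors in L²(ℝ₊; K), there exists a unitary operator W on L²(ℝ₊; K) such that for all ξ ∈ F and all t ∈ [0, a], ‖e^{iλt} ξ − W S̃_t W* ξ‖ < ε and ‖e^{−iλt} ξ − W S̃_t* W* ξ‖ < ε. -/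
open ContinuousLinearMap Filter Topology MeasureTheory

/-- A linear isometry of a subspace, extended by the identity on the orthogonal complement. -/
theorem exists_linearIsometryEquiv_extend {𝕜 H : Type*} [RCLike 𝕜] [NormedAddCommGroup H]
    [InnerProductSpace 𝕜 H] (E : Submodule 𝕜 H) [E.HasOrthogonalProjection] (e : E ≃ₗᵢ[𝕜] E) :
    ∃ U : H ≃ₗᵢ[𝕜] H, ∀ x : E, U x = e x := by
  let B : WithLp 2 (E × Eᗮ) ≃ₗᵢ[𝕜] WithLp 2 (E × Eᗮ) :=
    { (WithLp.linearEquiv 2 𝕜 (E × Eᗮ)).trans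
        ((e.toLinearEquiv.prodCongr (LinearEquiv.refl 𝕜 Eᗮ)).trans
          (WithLp.linearEquiv 2 𝕜 (E × Eᗮ)).symm) with
      norm_map' := fun x => by
        rw [← sq_eq_sq₀ (by positivity) (by positivity), WithLp.prod_norm_sq_eq_of_L2,
          WithLp.prod_norm_sq_eq_of_L2]
        simp }
  refine ⟨E.orthogonalDecomposition.trans (B.trans E.orthogonalDecomposition.symm), fun x => ?_⟩
  have h : ∀ y : E, E.orthogonalDecomposition (y : H) = WithLp.toLp 2 (y, 0) := fun y => by
    simp [Submodule.orthogonalDecomposition_apply]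
  rw [LinearIsometryEquiv.trans_apply, LinearIsometryEquiv.trans_apply,
    LinearIsometryEquiv.symm_apply_eq, h, h]
  change WithLp.toLp 2 (e x, (0 : Eᗮ)) = _
  rfl

theorem exists_linearIsometryEquiv_comp_eq {𝕜 V H : Type*} [RCLike 𝕜] [NormedAddCommGroup V]
    [InnerProductSpace 𝕜 V] [FiniteDimensional 𝕜 V] [NormedAddCommGroup H]
    [InnerProductSpace 𝕜 H] (i j : V →ₗᵢ[𝕜] H) :
    ∃ U : H ≃ₗᵢ[𝕜] H, ∀ v, U (i v) = j v := by
  let E : Submodule 𝕜 H := i.toLinearMap.range ⊔ j.toLinearMap.range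
  have hi : ∀ v, i v ∈ E := fun v => Submodule.mem_sup_left ⟨v, rfl⟩
  have hj : ∀ v, j v ∈ E := fun v => Submodule.mem_sup_right ⟨v, rfl⟩
  let i' : V →ₗᵢ[𝕜] E := ⟨i.toLinearMap.codRestrict E hi, fun v => i.norm_map v⟩
  let j' : V →ₗᵢ[𝕜] E := ⟨j.toLinearMap.codRestrict E hj, fun v => j.norm_map v⟩
  let L := (j'.comp i'.equivRange.symm.toLinearIsometry).extend
  obtain ⟨U, hU⟩ := exists_linearIsometryEquiv_extend E (L.toLinearIsometryEquiv rfl)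
  refine ⟨U, fun v => ?_⟩
  have h := hU (i' v)
  have h2 : L (i' v) = j' v := by
    have := LinearIsometry.extend_apply (j'.comp i'.equivRange.symm.toLinearIsometry)
      (i'.equivRange v)
    simpa using this
  rw [LinearIsometry.toLinearIsometryEquiv_apply, h2] at h
  exact h

theorem exists_linearIsometry_of_not_finiteDimensional (𝕜 V K : Type*) [RCLike 𝕜]
    [NormedAddCommGroup V] [InnerProductSpace 𝕜 V] [FiniteDimensional 𝕜 V]
    [NormedAddCommGroup K] [InnerProductSpace 𝕜 K] (hK : ¬ FiniteDimensional 𝕜 K) :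
    Nonempty (V →ₗᵢ[𝕜] K) := by
  have hrank : (Module.finrank 𝕜 V : Cardinal) ≤ Module.rank 𝕜 K :=
    Cardinal.natCast_le_aleph0.trans (not_lt.1 fun h => hK (Module.rank_lt_aleph0_iff.1 h))
  obtain ⟨s, hs, hli⟩ := exists_finset_linearIndependent_of_le_rank hrank
  let M : Submodule 𝕜 K := Submodule.span 𝕜 (s : Set K)
  have hM : Module.finrank 𝕜 M = Module.finrank 𝕜 V := by
    rw [finrank_span_finset_eq_card hli, hs]
  exact ⟨M.subtypeₗᵢ.comp
    ((stdOrthonormalBasis 𝕜 V).equiv (stdOrthonormalBasis 𝕜 M) (finCongr hM.symm)).toLinearIsometry⟩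

theorem norm_eq_of_ae_eq_indicator_comp_sub {K : Type*} [NormedAddCommGroup K] (t : ℝ)
    (f g : Lp K 2 (volume.restrict (Set.Ici (0 : ℝ))))
    (h : (g : ℝ → K) =ᵐ[volume.restrict (Set.Ici (0 : ℝ))]
      Set.indicator (Set.Ici t) (fun x => f (x - t))) (ht : 0 ≤ t) : ‖g‖ = ‖f‖ := by
  have hmp : MeasurePreserving (fun x : ℝ => x - t) (volume.restrict (Set.Ici t))
      (volume.restrict (Set.Ici 0)) := by
    have := (measurePreserving_sub_right volume t).restrict_preimage
      (measurableSet_Ici (a := (0 : ℝ)))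
    simpa using this
  rw [Lp.norm_def, Lp.norm_def, eLpNorm_congr_ae h,
    eLpNorm_indicator_eq_eLpNorm_restrict measurableSet_Ici,
    Measure.restrict_restrict measurableSet_Ici,
    Set.inter_eq_left.2 (Set.Ici_subset_Ici.2 ht),
    ← eLpNorm_comp_measurePreserving (Lp.aestronglyMeasurable f) hmp]
  rfl

/-- The normalized truncation `N^(-1/2) e^{-iλx} 1_{[0,N)}(x)` of a character. -/
noncomputable def truncatedCharacter (lam N : ℝ) : ℝ → ℂ :=
  Set.indicator (Set.Ico 0 N)
    (fun x => ((√N)⁻¹ : ℂ) * Complex.exp (-(Complex.I * lam * x)))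

theorem norm_truncatedCharacter (lam N x : ℝ) :
    ‖truncatedCharacter lam N x‖ = Set.indicator (Set.Ico 0 N) (fun _ => (√N)⁻¹) x := by
  rw [truncatedCharacter, norm_indicator_eq_indicator_norm]
  simp [Complex.norm_exp, abs_of_nonneg]

theorem memLp_truncatedCharacter (lam N : ℝ) (s : Set ℝ) :
    MemLp (truncatedCharacter lam N) 2 (volume.restrict s) := by
  have hm : AEStronglyMeasurable (truncatedCharacter lam N) (volume.restrict s) :=
    (Continuous.measurable (by fun_prop)).aestronglyMeasurable.indicator measurableSet_Ico
  refine MemLp.of_le (g := Set.indicator (Set.Ico 0 N) (fun _ : ℝ => (√N)⁻¹)) ?_ hm ?_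
  · refine memLp_indicator_const 2 measurableSet_Ico _ (Or.inr ?_)
    exact ((Measure.restrict_apply_le s _).trans_lt measure_Ico_lt_top).ne
  · filter_upwards with x
    rw [norm_truncatedCharacter]
    exact le_abs_self _

theorem memLp_smul_const {α : Type*} [MeasurableSpace α] {μ : Measure α} {K : Type*}
    [NormedAddCommGroup K] [NormedSpace ℂ K] {g : α → ℂ} (hg : MemLp g 2 μ) (k : K) :
    MemLp (fun x => g x • k) 2 μ :=
  (toSpanSingleton ℂ k).comp_memLp' hg

/-- The linear map `k ↦ g ⊗ k`. -/
noncomputable def tensorLp {α : Type*} [MeasurableSpace α] {μ : Measure α} (K : Type*)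
    [NormedAddCommGroup K] [NormedSpace ℂ K] (g : α → ℂ) (hg : MemLp g 2 μ) :
    K →ₗ[ℂ] Lp K 2 μ where
  toFun k := (memLp_smul_const hg k).toLp _
  map_add' k l := by
    rw [← MemLp.toLp_add]; congr; ext; simp
  map_smul' c k := by
    rw [RingHom.id_apply, ← MemLp.toLp_const_smul]; congr; ext; simp [smul_comm c]

theorem coeFn_tensorLp {α : Type*} [MeasurableSpace α] {μ : Measure α} {K : Type*}
    [NormedAddCommGroup K] [NormedSpace ℂ K] (g : α → ℂ) (hg : MemLp g 2 μ) (k : K) :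
    tensorLp K g hg k =ᵐ[μ] fun x => g x • k :=
  MemLp.coeFn_toLp (memLp_smul_const hg k)

theorem norm_tensorLp_truncatedCharacter {K : Type*} [NormedAddCommGroup K] [NormedSpace ℂ K]
    (lam N : ℝ) (hN : 0 < N) (k : K) :
    ‖tensorLp K _ (memLp_truncatedCharacter lam N (Set.Ici 0)) k‖ = ‖k‖ := by
  have hfin : (volume.restrict (Set.Ici (0 : ℝ))) (Set.Ico 0 N) ≠ ⊤ :=
    ((Measure.restrict_apply_le _ _).trans_lt measure_Ico_lt_top).ne
  have hreal : (volume.restrict (Set.Ici (0 : ℝ))).real (Set.Ico 0 N) = N := by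
    rw [measureReal_restrict_apply measurableSet_Ico,
      Set.inter_eq_left.2 Set.Ico_subset_Ici_self]
    simp [hN.le]
  have hnorm : ‖indicatorConstLp 2 measurableSet_Ico hfin ((√N)⁻¹ * ‖k‖)‖ = ‖k‖ := by
    rw [norm_indicatorConstLp (by simp) (by simp), hreal]
    have : 0 < √N := Real.sqrt_pos.2 hN
    rw [norm_mul, norm_norm, Real.norm_of_nonneg (by positivity), ENNReal.toReal_ofNat,
      ← Real.sqrt_eq_rpow]
    field_simp
  rw [← hnorm]
  have hpt : ∀ᵐ x ∂(volume.restrict (Set.Ici (0 : ℝ))),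
      ‖tensorLp K _ (memLp_truncatedCharacter lam N (Set.Ici 0)) k x‖ =
        ‖indicatorConstLp 2 measurableSet_Ico hfin ((√N)⁻¹ * ‖k‖) x‖ := by
    filter_upwards [coeFn_tensorLp _ (memLp_truncatedCharacter lam N (Set.Ici 0)) k,
      indicatorConstLp_coeFn (p := 2) (hs := measurableSet_Ico) (hμs := hfin)
        (c := (√N)⁻¹ * ‖k‖)] with x h1 h2
    rw [h1, h2, norm_smul, norm_truncatedCharacter, norm_indicator_eq_indicator_norm]
    by_cases hx : x ∈ Set.Ico 0 N <;> simp [hx, abs_of_nonneg]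
  exact le_antisymm (Lp.norm_le_norm_of_ae_le (hpt.mono fun _ h => h.le))
    (Lp.norm_le_norm_of_ae_le (hpt.mono fun _ h => h.ge))

theorem norm_exp_mul_truncatedCharacter_sub_le (lam N a t x : ℝ) (ht : 0 ≤ t) (hta : t ≤ a)
    (hx : 0 ≤ x) :
    ‖Complex.exp (Complex.I * lam * t) * truncatedCharacter lam N x
        - Set.indicator (Set.Ici t) (fun x => truncatedCharacter lam N (x - t)) x‖ ≤
      Set.indicator (Set.Ico 0 a ∪ Set.Ico N (N + a)) (fun _ => (√N)⁻¹) x := by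
  have hexp : ∀ y : ℝ, ‖Complex.exp (Complex.I * lam * y)‖ = 1 := fun y => by
    rw [Complex.norm_exp]; simp
  have hr : 0 ≤ (√N)⁻¹ := by positivity
  have hn := norm_truncatedCharacter lam N
  have hle : ∀ y, ‖truncatedCharacter lam N y‖ ≤ (√N)⁻¹ := fun y => by
    rw [hn]; exact Set.indicator_le_self' (fun _ _ => hr) y
  by_cases hxt : x < t
  · rw [Set.indicator_of_notMem (by simpa using hxt),
      Set.indicator_of_mem (Set.mem_union_left _ (Set.mem_Ico.2 ⟨hx, hxt.trans_le hta⟩)), sub_zero, norm_mul, hexp, one_mul]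
    exact hle x
  push Not at hxt
  rw [Set.indicator_of_mem (show x ∈ Set.Ici t from hxt)]
  by_cases hxN : x < N
  · have : Complex.exp (Complex.I * lam * t) * truncatedCharacter lam N x
        = truncatedCharacter lam N (x - t) := by
      rw [truncatedCharacter, Set.indicator_of_mem (Set.mem_Ico.2 ⟨hx, hxN⟩),
        Set.indicator_of_mem (by constructor <;> linarith), mul_left_comm, ← Complex.exp_add]
      congr 2
      push_cast
      ring
    rw [this, sub_self, norm_zero]
    exact Set.indicator_nonneg (fun _ _ => hr) x
  push Not at hxN
  have h0 : truncatedCharacter lam N x = 0 :=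
    Set.indicator_of_notMem (fun h => absurd h.2 (not_lt.2 hxN)) _
  rw [h0, mul_zero, zero_sub, norm_neg]
  by_cases hxa : x < N + a
  · rw [Set.indicator_of_mem (Set.mem_union_right _ (Set.mem_Ico.2 ⟨hxN, hxa⟩))]
    exact hle _
  · rw [hn, Set.indicator_of_notMem fun h => hxa (by linarith [h.2])]
    exact Set.indicator_nonneg (fun _ _ => hr) x

theorem norm_exp_smul_tensorLp_sub_le {K : Type*} [NormedAddCommGroup K] [NormedSpace ℂ K]
    (lam N a t : ℝ) (ht : 0 ≤ t) (hta : t ≤ a) (k : K)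
    (g : Lp K 2 (volume.restrict (Set.Ici (0 : ℝ))))
    (h : (g : ℝ → K) =ᵐ[volume.restrict (Set.Ici (0 : ℝ))] Set.indicator (Set.Ici t)
      (fun x => tensorLp K _ (memLp_truncatedCharacter lam N (Set.Ici 0)) k (x - t))) :
    ‖Complex.exp (Complex.I * lam * t) •
        tensorLp K _ (memLp_truncatedCharacter lam N (Set.Ici 0)) k - g‖ ≤
      (√N)⁻¹ * ‖k‖ * √(2 * a) := by
  set A : Set ℝ := Set.Ico 0 a ∪ Set.Ico N (N + a)
  have hA : MeasurableSet A := measurableSet_Ico.union measurableSet_Ico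
  have ha : 0 ≤ a := ht.trans hta
  have hvol : (volume.restrict (Set.Ici (0 : ℝ))) A ≤ ENNReal.ofReal (2 * a) := by
    refine (Measure.restrict_apply_le _ _).trans ((measure_union_le _ _).trans ?_)
    rw [Real.volume_Ico, Real.volume_Ico, ← ENNReal.ofReal_add (by linarith) (by linarith)]
    exact ENNReal.ofReal_le_ofReal (by linarith)
  have hfin : (volume.restrict (Set.Ici (0 : ℝ))) A ≠ ⊤ := ne_top_of_le_ne_top ENNReal.ofReal_ne_top hvol
  have hnorm : ‖indicatorConstLp 2 hA hfin ((√N)⁻¹ * ‖k‖)‖ ≤ (√N)⁻¹ * ‖k‖ * √(2 * a) := by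
    rw [norm_indicatorConstLp (by simp) (by simp), Real.norm_of_nonneg (by positivity),
      ENNReal.toReal_ofNat, ← Real.sqrt_eq_rpow]
    gcongr
    exact ENNReal.toReal_le_of_le_ofReal (by linarith) hvol
  refine (Lp.norm_le_norm_of_ae_le ?_).trans hnorm
  have hT := coeFn_tensorLp _ (memLp_truncatedCharacter lam N (Set.Ici 0)) k
  have hshift : ∀ᵐ x ∂(volume.restrict (Set.Ici (0 : ℝ))), x ∈ Set.Ici t →
      tensorLp K _ (memLp_truncatedCharacter lam N (Set.Ici 0)) k (x - t) =
        truncatedCharacter lam N (x - t) • k := by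
    have hq := (measurePreserving_sub_right volume t).quasiMeasurePreserving.ae
      ((ae_restrict_iff' measurableSet_Ici).1 hT)
    refine ae_restrict_of_ae (hq.mono fun x hx hxt => hx ?_)
    simpa using hxt
  filter_upwards [hT, hshift, h, ae_restrict_mem measurableSet_Ici,
    Lp.coeFn_sub (Complex.exp (Complex.I * lam * t) •
      tensorLp K _ (memLp_truncatedCharacter lam N (Set.Ici 0)) k) g,
    Lp.coeFn_smul (Complex.exp (Complex.I * lam * t))
      (tensorLp K _ (memLp_truncatedCharacter lam N (Set.Ici 0)) k),
    indicatorConstLp_coeFn (p := 2) (hs := hA) (hμs := hfin) (c := (√N)⁻¹ * ‖k‖)]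
    with x h1 h2 h3 h4 h5 h6 h7
  have key := norm_exp_mul_truncatedCharacter_sub_le lam N a t x ht hta h4
  have hind : Set.indicator (Set.Ici t)
      (fun x => tensorLp K _ (memLp_truncatedCharacter lam N (Set.Ici 0)) k (x - t)) x =
      Set.indicator (Set.Ici t) (fun x => truncatedCharacter lam N (x - t)) x • k := by
    by_cases hx : x ∈ Set.Ici t
    · rw [Set.indicator_of_mem hx, Set.indicator_of_mem hx, h2 hx]
    · rw [Set.indicator_of_notMem hx, Set.indicator_of_notMem hx, zero_smul]
  rw [h5, Pi.sub_apply, h6, Pi.smul_apply, h1, h3, hind, h7, smul_smul, ← sub_smul, norm_smul,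
    norm_indicator_eq_indicator_norm]
  refine (mul_le_mul_of_nonneg_right key (norm_nonneg k)).trans (le_of_eq ?_)
  by_cases hx : x ∈ A <;> simp [A, hx, abs_of_nonneg]

theorem norm_inv_smul_sub_adjoint_le {H : Type*} [NormedAddCommGroup H] [InnerProductSpace ℂ H]
    [CompleteSpace H] (S : H →L[ℂ] H) (hS : ∀ x, ‖S x‖ = ‖x‖) (z : ℂ) (hz : ‖z‖ = 1) (x : H) :
    ‖z⁻¹ • x - adjoint S x‖ ≤ ‖z • x - S x‖ := by
  have hz0 : z ≠ 0 := by rintro rfl; simp at hz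
  have h1 : adjoint S (S x) = x := by
    have := (norm_map_iff_adjoint_comp_self S).1 hS
    exact congrArg (fun T : H →L[ℂ] H => T x) this
  have hnorm : ‖adjoint S‖ ≤ 1 := by
    rw [LinearIsometryEquiv.norm_map]
    exact S.opNorm_le_bound zero_le_one fun y => by rw [hS, one_mul]
  have h2 : z⁻¹ • x - adjoint S x = -(z⁻¹ • adjoint S (z • x - S x)) := by
    rw [map_sub, map_smul, h1, smul_sub, smul_smul, inv_mul_cancel₀ hz0, one_smul, neg_sub]
  rw [h2, norm_neg, norm_smul, norm_inv, hz, inv_one, one_mul]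
  exact (adjoint S).le_of_opNorm_le hnorm _ |>.trans_eq (one_mul _)

/-- the `K`-valued shift semigroup `S̃` on `L²(ℝ₊; K)` (`K` an
infinite-dimensional separable Hilbert space) approximately contains every character of ℝ₊:
for all `λ ∈ ℝ`, `ε > 0`, `a > 0` and every finite set `F` of unit vectors, there is a unitary
`W` with `‖e^{iλt} ξ - W S̃_t W* ξ‖ < ε` and `‖e^{-iλt} ξ - W S̃_t* W* ξ‖ < ε` for all `ξ ∈ F`
and all `t ∈ [0, a]`. `L²(ℝ₊; K)` is realized as `Lp K 2 μ` with `μ` the Lebesgue measure on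
`ℝ` restricted to `[0, ∞)`. -/
theorem stmt_14
    (K : Type*) [NormedAddCommGroup K] [InnerProductSpace ℂ K] [CompleteSpace K]
    [TopologicalSpace.SeparableSpace K] (hK : ¬ FiniteDimensional ℂ K)
    (S : NNReal → (Lp K 2 (volume.restrict (Set.Ici (0 : ℝ))) →L[ℂ]
      Lp K 2 (volume.restrict (Set.Ici (0 : ℝ)))))
    (hS : ∀ (t : NNReal) (f : Lp K 2 (volume.restrict (Set.Ici (0 : ℝ)))),
      (S t f : ℝ → K) =ᵐ[volume.restrict (Set.Ici (0 : ℝ))]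
        Set.indicator (Set.Ici (t : ℝ)) (fun x => f (x - (t : ℝ))))
    (lam : ℝ) (ε : ℝ) (hε : 0 < ε) (a : ℝ) (ha : 0 < a)
    (F : Finset (Lp K 2 (volume.restrict (Set.Ici (0 : ℝ)))))
    (hF : ∀ ξ ∈ F, ‖ξ‖ = 1) :
    ∃ W : Lp K 2 (volume.restrict (Set.Ici (0 : ℝ))) ≃ₗᵢ[ℂ]
        Lp K 2 (volume.restrict (Set.Ici (0 : ℝ))),
      ∀ ξ ∈ F, ∀ t : NNReal, (t : ℝ) ≤ a →
        ‖Complex.exp (Complex.I * lam * ((t : ℝ) : ℂ)) • ξ - W (S t (W.symm ξ))‖ < ε ∧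
        ‖Complex.exp (-(Complex.I * lam * ((t : ℝ) : ℂ))) • ξ
            - W (adjoint (S t) (W.symm ξ))‖ < ε := by
  obtain ⟨N, hN⟩ := exists_gt (2 * a / ε ^ 2)
  have hN0 : 0 < N := lt_of_le_of_lt (by positivity) hN
  let T : K →ₗᵢ[ℂ] Lp K 2 (volume.restrict (Set.Ici (0 : ℝ))) :=
    ⟨tensorLp K _ (memLp_truncatedCharacter lam N (Set.Ici 0)),
      norm_tensorLp_truncatedCharacter lam N hN0⟩
  let V : Submodule ℂ (Lp K 2 (volume.restrict (Set.Ici (0 : ℝ)))) :=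
    Submodule.span ℂ (F : Set (Lp K 2 (volume.restrict (Set.Ici (0 : ℝ)))))
  have hV : FiniteDimensional ℂ V := FiniteDimensional.span_finset ℂ F
  obtain ⟨j⟩ := exists_linearIsometry_of_not_finiteDimensional ℂ V K hK
  obtain ⟨W, hW⟩ := exists_linearIsometryEquiv_comp_eq (T.comp j) V.subtypeₗᵢ
  refine ⟨W, fun ξ hξ t hta => ?_⟩
  let v : V := ⟨ξ, Submodule.subset_span hξ⟩
  have hWξ : W (T (j v)) = ξ := hW v
  have hk : ‖j v‖ = 1 := (j.norm_map v).trans (hF ξ hξ)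
  have hiso : ∀ f, ‖S t f‖ = ‖f‖ := fun f =>
    norm_eq_of_ae_eq_indicator_comp_sub t f _ (hS t f) t.2
  have hz : ‖Complex.exp (Complex.I * lam * ((t : ℝ) : ℂ))‖ = 1 := by
    rw [Complex.norm_exp]; simp
  have hbound : ‖Complex.exp (Complex.I * lam * ((t : ℝ) : ℂ)) • T (j v) - S t (T (j v))‖ < ε := by
    refine (norm_exp_smul_tensorLp_sub_le lam N a t t.2 hta (j v) _ (hS t _)).trans_lt ?_
    rw [hk, mul_one, inv_mul_lt_iff₀ (Real.sqrt_pos.2 hN0),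
      Real.sqrt_lt' (by positivity), mul_pow, Real.sq_sqrt hN0.le]
    exact (div_lt_iff₀ (by positivity)).1 hN
  rw [← hWξ, W.symm_apply_apply, ← map_smul W, ← map_smul W, ← map_sub W, ← map_sub W, W.norm_map,
    W.norm_map, Complex.exp_neg]
  exact ⟨hbound, (norm_inv_smul_sub_adjoint_le (S t) hiso _ hz _).trans_lt hbound⟩
end

section
/- Let γ be the standard Gaussian probability measure on ℝ and μ := ⊗_{n∈ℕ} γ the infinite product probability measure on ℝ^ℕ. Let (a_n)_{n∈ℕ} be a sequence with a_n ≤ 0 for all n such that the partial products ∏_{n=1}^N γ([a_n,∞)) converge to a strictly positive limit, and set A := {y ∈ ℝ^ℕ : y_n ≥ a_n for all n}, so that μ(A) > 0. Suppose (V_x)_{x∈ℝ₊^∞} is a family of isometries on L²(A) (the L² space of μ restricted to A) such that for every x ∈ ℝ₊^∞ with x_n = 0 for n > k, every f ∈ L²(A), and μ-a.e. y ∈ A: (V_x f)(y) = (∏_{n=1}^k e^{(2 x_n y_n − x_n²)/2})^{1/2} f(y−x) if y−x ∈ A, and (V_x f)(y) = 0 otherwise. Then every bounded linear operator T on L²(A)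 satisfying T V_x = V_x T and T V_x* = V_x* T for all x ∈ ℝ₊^∞ is a scalar multiple of the identity; i.e. the representation V^A is irreducible. -/
open ContinuousLinearMap Filter Topology MeasureTheory

/-- `μ` is the infinite product `⊗_{n∈ℕ} γ` of the standard Gaussian measure `γ` on `ℝ`:
it is a probability measure whose values on cylinder sets are the corresponding finite
products of Gaussian measures. -/
def IsGaussianProduct (μ : Measure (ℕ → ℝ)) : Prop :=
  IsProbabilityMeasure μ ∧
  ∀ (k : ℕ) (s : ℕ → Set ℝ), (∀ n, MeasurableSet (s n)) → (∀ n, k ≤ n → s n = Set.univ) →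
    μ {y : ℕ → ℝ | ∀ n, y n ∈ s n}
      = ∏ n ∈ Finset.range k, ProbabilityTheory.gaussianReal 0 1 (s n)

/-- `V` is the family of isometries `V^A` on `L²(A) = Lp ℂ 2 (μ.restrict A)` determined by
`(V_x f)(y) = (∏_{n<k} e^{(2 x_n y_n - x_n²)/2})^{1/2} f(y - x)` if `y - x ∈ A`, `0`
otherwise, for `x ∈ ℝ₊^∞` supported in the first `k` coordinates. -/
def IsGaussianShiftRep (μ : Measure (ℕ → ℝ)) (A : Set (ℕ → ℝ))
    (V : (ℕ → NNReal) → (Lp ℂ 2 (μ.restrict A) →L[ℂ] Lp ℂ 2 (μ.restrict A))) : Prop :=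
  (∀ x : ℕ → NNReal, (∃ k, ∀ n, k ≤ n → x n = 0) →
    ∀ f : Lp ℂ 2 (μ.restrict A), ‖V x f‖ = ‖f‖) ∧
  ∀ (x : ℕ → NNReal) (k : ℕ), (∀ n, k ≤ n → x n = 0) →
    ∀ f : Lp ℂ 2 (μ.restrict A),
      (V x f : (ℕ → ℝ) → ℂ) =ᵐ[μ.restrict A]
        Set.indicator {y : ℕ → ℝ | (fun n => y n - (x n : ℝ)) ∈ A}
          (fun y => (Real.sqrt (∏ n ∈ Finset.range k,
              Real.exp ((2 * (x n : ℝ) * y n - (x n : ℝ) ^ 2) / 2)) : ℂ)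
            * f (fun n => y n - (x n : ℝ)))

open ProbabilityTheory

/-- The density of the standard Gaussian measure translated by `x` with respect to the standard
Gaussian measure. -/
noncomputable def gaussianShiftDensity (x t : ℝ) : ENNReal :=
  ENNReal.ofReal (Real.exp (x * t - x ^ 2 / 2))

/-- Translation by `x` in the `k`-th coordinate. -/
noncomputable def coordShift (k : ℕ) (x : ℝ) (y : ℕ → ℝ) : ℕ → ℝ :=
  fun n => y n + Pi.single (M := fun _ => ℝ) k x n

@[fun_prop]
lemma measurable_gaussianShiftDensity (x : ℝ) : Measurable (gaussianShiftDensity x) := by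
  unfold gaussianShiftDensity; fun_prop

lemma measurable_gaussianShiftDensity_eval (k : ℕ) (x : ℝ) :
    Measurable (fun y : ℕ → ℝ => gaussianShiftDensity x (y k)) :=
  (measurable_gaussianShiftDensity x).comp (measurable_pi_apply k)

@[fun_prop]
lemma measurable_coordShift (k : ℕ) (x : ℝ) : Measurable (coordShift k x) := by
  unfold coordShift; fun_prop

@[simp]
lemma coordShift_same (k : ℕ) (x : ℝ) (y : ℕ → ℝ) : coordShift k x y k = y k + x := by
  simp [coordShift]

lemma coordShift_of_ne {k n : ℕ} (h : n ≠ k) (x : ℝ) (y : ℕ → ℝ) :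
    coordShift k x y n = y n := by
  simp [coordShift, h]

@[simp]
lemma coordShift_coordShift_neg (k : ℕ) (x : ℝ) (y : ℕ → ℝ) :
    coordShift k x (coordShift k (-x) y) = y := by
  ext n; by_cases h : n = k
  · subst h; simp
  · simp [coordShift_of_ne h]

@[simp]
lemma coordShift_neg_coordShift (k : ℕ) (x : ℝ) (y : ℕ → ℝ) :
    coordShift k (-x) (coordShift k x y) = y := by
  simpa using coordShift_coordShift_neg k (-x) y

lemma gaussianReal_map_add_eq_withDensity (x : ℝ) :
    (gaussianReal 0 1).map (· + x) = (gaussianReal 0 1).withDensity (gaussianShiftDensity x) := by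
  rw [gaussianReal_map_add_const, gaussianReal_of_var_ne_zero _ one_ne_zero,
    gaussianReal_of_var_ne_zero _ one_ne_zero, ← withDensity_mul _ (measurable_gaussianPDF _ _)
      (measurable_gaussianShiftDensity x)]
  congr 1
  ext t
  simp only [gaussianPDF, gaussianPDFReal, gaussianShiftDensity, Pi.mul_apply]
  rw [← ENNReal.ofReal_mul (by positivity), mul_assoc (√_)⁻¹,
    ← Real.exp_add]
  congr 3
  simp
  ring

lemma IsGaussianProduct.eq_infinitePi {μ : Measure (ℕ → ℝ)} (hμ : IsGaussianProduct μ) :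
    μ = Measure.infinitePi (fun _ : ℕ => gaussianReal 0 1) := by
  classical
  refine Measure.eq_infinitePi _ fun s t ht => ?_
  have h := hμ.2 (s.sup id + 1) (fun n => if n ∈ s then t n else Set.univ)
    (fun n => by split_ifs; exacts [ht n, .univ])
    (fun n hn => if_neg fun hs => by
      have : n ≤ s.sup id := Finset.le_sup (f := id) hs
      omega)
  have hset : (s : Set ℕ).pi t = {y | ∀ n, y n ∈ if n ∈ s then t n else Set.univ} := by
    ext y
    simp only [Set.mem_pi, Set.mem_ofPred_eq, Finset.mem_coe]
    refine forall_congr' fun n => ?_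
    split_ifs with hn <;> simp [hn]
  rw [hset, h]
  rw [← Finset.prod_subset (s₁ := s)]
  · exact Finset.prod_congr rfl fun n hn => by simp only [if_pos hn]
  · intro n hn
    have : n ≤ s.sup id := Finset.le_sup (f := id) hn
    rw [Finset.mem_range]; omega
  · intro n _ hn
    simp only [if_neg hn, measure_univ]

lemma map_eval_restrict_pi (k : ℕ) (r : Finset ℕ) (hk : k ∉ r) (t : ℕ → Set ℝ)
    (ht : ∀ n, MeasurableSet (t n)) :
    ((Measure.infinitePi (fun _ : ℕ => gaussianReal 0 1)).restrict ((r : Set ℕ).pi t)).map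
      (fun y => y k) = (∏ n ∈ r, gaussianReal 0 1 (t n)) • gaussianReal 0 1 := by
  classical
  ext E hE
  have hset : (fun y : ℕ → ℝ => y k) ⁻¹' E ∩ (r : Set ℕ).pi t
      = ((insert k r : Finset ℕ) : Set ℕ).pi (Function.update t k E) := by
    ext y
    simp only [Set.mem_inter_iff, Set.mem_preimage, Set.mem_pi, Finset.coe_insert,
      Set.mem_insert_iff, Finset.mem_coe, forall_eq_or_imp, Function.update_self]
    refine and_congr_right fun _ => forall₂_congr fun n hn => ?_
    rw [Function.update_of_ne (ne_of_mem_of_not_mem hn hk)]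
  rw [Measure.map_apply (measurable_pi_apply k) hE,
    Measure.restrict_apply (measurable_pi_apply k hE), hset,
    Measure.infinitePi_pi, Finset.prod_insert hk]
  · rw [Function.update_self, mul_comm, Measure.smul_apply, smul_eq_mul]
    congr 1
    refine Finset.prod_congr rfl fun n hn => ?_
    rw [Function.update_of_ne (ne_of_mem_of_not_mem hn hk)]
  · intro n _
    by_cases h : n = k
    · subst h; simpa using hE
    · simpa [h] using ht n

/-- The Cameron–Martin formula for translations in one coordinate. -/
lemma IsGaussianProduct.map_coordShift {μ : Measure (ℕ → ℝ)} (hμ : IsGaussianProduct μ)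
    (k : ℕ) (x : ℝ) :
    μ.map (coordShift k x) = μ.withDensity (fun y => gaussianShiftDensity x (y k)) := by
  classical
  rw [hμ.eq_infinitePi]
  set P := Measure.infinitePi (fun _ : ℕ => gaussianReal 0 1) with hP
  let γ' : ℕ → Measure ℝ := fun n => (gaussianReal 0 1).map
    (fun t => t + Pi.single (M := fun _ => ℝ) k x n)
  have hγ' : ∀ n, IsProbabilityMeasure (γ' n) := fun n =>
    Measure.isProbabilityMeasure_map (by fun_prop)
  have h1 : P.map (coordShift k x) = Measure.infinitePi γ' :=
    Measure.infinitePi_map_pi (μ := fun _ : ℕ => gaussianReal 0 1)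
      (f := fun n t => t + Pi.single (M := fun _ => ℝ) k x n) (fun n => by fun_prop)
  have hne : ∀ n, n ≠ k → γ' n = gaussianReal 0 1 := fun n hn => by
    simp [γ', hn]
  have hk : γ' k = (gaussianReal 0 1).withDensity (gaussianShiftDensity x) := by
    simp only [γ', Pi.single_eq_same]
    exact gaussianReal_map_add_eq_withDensity x
  rw [h1]
  symm
  refine Measure.eq_infinitePi _ fun s t ht => ?_
  have hset : (s : Set ℕ).pi t = (fun y : ℕ → ℝ => y k) ⁻¹' (if k ∈ s then t k else Set.univ)
      ∩ ((s.erase k : Finset ℕ) : Set ℕ).pi t := by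
    ext y
    simp only [Set.mem_inter_iff, Set.mem_preimage, Set.mem_pi, Finset.mem_coe, Finset.mem_erase]
    constructor
    · intro h
      refine ⟨?_, fun n hn => h n hn.2⟩
      split_ifs with hs
      exacts [h k hs, trivial]
    · rintro ⟨h1, h2⟩ n hn
      by_cases hnk : n = k
      · subst hnk; simpa [hn] using h1
      · exact h2 n ⟨hnk, hn⟩
  have hT : MeasurableSet (if k ∈ s then t k else Set.univ) := by
    split_ifs; exacts [ht k, .univ]
  have hpi : MeasurableSet (((s.erase k : Finset ℕ) : Set ℕ).pi t) :=
    .pi (Finset.countable_toSet _) fun n _ => ht n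
  rw [hset, withDensity_apply _ ((measurable_pi_apply k hT).inter hpi),
    ← Measure.restrict_restrict (measurable_pi_apply k hT),
    ← setLIntegral_map (f := gaussianShiftDensity x) hT (by fun_prop) (measurable_pi_apply k),
    map_eval_restrict_pi k _ (Finset.notMem_erase k s) t ht, Measure.restrict_smul,
    lintegral_smul_measure, ← withDensity_apply _ hT, ← hk, smul_eq_mul]
  have hprod : ∏ n ∈ s.erase k, gaussianReal 0 1 (t n) = ∏ n ∈ s.erase k, γ' n (t n) :=
    Finset.prod_congr rfl fun n hn => by rw [hne n (Finset.ne_of_mem_erase hn)]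
  rw [hprod]
  split_ifs with hs
  · rw [Finset.prod_erase_mul s _ hs]
  · rw [Finset.erase_eq_of_notMem hs, measure_univ, mul_one]

lemma IsGaussianProduct.lintegral_coordShift {μ : Measure (ℕ → ℝ)} (hμ : IsGaussianProduct μ)
    (k : ℕ) (x : ℝ) {F : (ℕ → ℝ) → ENNReal} (hF : AEMeasurable F μ) :
    ∫⁻ y, F (coordShift k x y) ∂μ = ∫⁻ y, gaussianShiftDensity x (y k) * F y ∂μ := by
  have hac : μ.map (coordShift k x) ≪ μ := by
    rw [hμ.map_coordShift]; exact withDensity_absolutelyContinuous _ _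
  rw [← lintegral_map' (hF.mono_ac hac) (by fun_prop), hμ.map_coordShift,
    lintegral_withDensity_eq_lintegral_mul₀
      (measurable_gaussianShiftDensity_eval k x).aemeasurable hF]
  rfl

lemma IsGaussianProduct.quasiMeasurePreserving_coordShift {μ : Measure (ℕ → ℝ)}
    (hμ : IsGaussianProduct μ) (k : ℕ) (x : ℝ) :
    Measure.QuasiMeasurePreserving (coordShift k x) μ μ :=
  ⟨by fun_prop, by rw [hμ.map_coordShift]; exact withDensity_absolutelyContinuous _ _⟩

lemma volume_mul_eq_of_translation_invariant {m : Measure ℝ} [SFinite m] {a : ℝ}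
    (h : ∀ x, 0 ≤ x → ∀ E, MeasurableSet E → E ⊆ Set.Ici a → m ((fun t => t - x) ⁻¹' E) = m E)
    {D E : Set ℝ} (hD : MeasurableSet D) (hE : MeasurableSet E) (hDa : D ⊆ Set.Ici a)
    (hEa : E ⊆ Set.Ici a) :
    volume D * m E = volume E * m D := by
  have key : ∀ D E : Set ℝ, MeasurableSet D → MeasurableSet E → D ⊆ Set.Ici a → E ⊆ Set.Ici a →
      volume D * m E = ∫⁻ x, ∫⁻ t, D.indicator 1 x * E.indicator 1 (t - (x - a)) ∂m := by
    intro D E hD hE hDa hEa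
    have : ∀ x, ∫⁻ t, D.indicator 1 x * E.indicator 1 (t - (x - a)) ∂m
        = D.indicator (fun _ => m E) x := by
      intro x
      by_cases hx : x ∈ D
      · have hx' : 0 ≤ x - a := sub_nonneg.2 (hDa hx)
        simp only [Set.indicator_of_mem hx, Pi.one_apply, one_mul]
        rw [← h (x - a) hx' E hE hEa,
          ← lintegral_indicator_one (measurableSet_preimage (by fun_prop) hE)]
        rfl
      · simp [Set.indicator_of_notMem hx]
    simp_rw [this]
    rw [lintegral_indicator hD, setLIntegral_const, mul_comm]
  have hmeas : ∀ D E : Set ℝ, MeasurableSet D → MeasurableSet E →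
      Measurable (fun p : ℝ × ℝ => D.indicator (1 : ℝ → ENNReal) p.1
        * E.indicator (1 : ℝ → ENNReal) (p.2 - (p.1 - a))) := fun D E hD hE =>
    ((measurable_one.indicator hD).comp measurable_fst).mul
      ((measurable_one.indicator hE).comp (by fun_prop))
  have swap := fun D E hD hE => lintegral_lintegral_swap (μ := volume) (ν := m)
    (f := fun x t => D.indicator 1 x * E.indicator 1 (t - (x - a))) (hmeas D E hD hE).aemeasurable
  rw [key D E hD hE hDa hEa, key E D hE hD hEa hDa, swap D E hD hE, swap E D hE hD]
  refine lintegral_congr fun t => ?_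
  rw [← lintegral_sub_left_eq_self _ (t + a)]
  refine lintegral_congr fun z => ?_
  rw [mul_comm]
  congr 2 <;> ring_nf

/-- A set which is invariant under positive translations in the coordinate `k`, among points
whose `k`-th coordinate is at least `a`, is independent of the `k`-th coordinate there. -/
lemma IsGaussianProduct.measure_inter_eval_mem {μ : Measure (ℕ → ℝ)} (hμ : IsGaussianProduct μ)
    (k : ℕ) (a : ℝ) {D : Set (ℕ → ℝ)} (hD : MeasurableSet D)
    (hinv : ∀ x, 0 ≤ x → ∀ᵐ y ∂μ, a ≤ y k → (coordShift k x y ∈ D ↔ y ∈ D))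
    {E : Set ℝ} (hE : MeasurableSet E) (hEa : E ⊆ Set.Ici a) :
    μ (D ∩ {y | y k ∈ E}) * gaussianReal 0 1 (Set.Ici a)
      = gaussianReal 0 1 E * μ (D ∩ {y | a ≤ y k}) := by
  have := hμ.1
  set m : Measure ℝ := (μ.restrict D).map (fun y => y k) with hm
  have hev : Measurable (fun y : ℕ → ℝ => y k) := measurable_pi_apply k
  let w : ℝ → ENNReal := fun t => ENNReal.ofReal (Real.exp (t ^ 2 / 2))
  have hw : Measurable w := by fun_prop
  have hw0 : ∀ t, w t ≠ 0 := fun t => by simp [w, Real.exp_pos]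
  have hwt : ∀ t, w t ≠ ⊤ := fun t => by simp [w]
  have hmE : ∀ E, MeasurableSet E → m E = μ (D ∩ {y | y k ∈ E}) := fun E hE => by
    rw [hm, Measure.map_apply hev hE, Measure.restrict_apply (hev hE), Set.inter_comm]; rfl
  have hm' : ∀ E, MeasurableSet E → m.withDensity w E
      = ∫⁻ y, (D ∩ {y | y k ∈ E}).indicator (fun y => w (y k)) y ∂μ := fun E hE => by
    rw [withDensity_apply _ hE, hm, setLIntegral_map hE hw hev,
      Measure.restrict_restrict (hev hE), Set.inter_comm]
    exact (lintegral_indicator (hD.inter (hev hE)) _).symm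
  have htr : ∀ x, 0 ≤ x → ∀ E, MeasurableSet E → E ⊆ Set.Ici a →
      m.withDensity w ((fun t => t - x) ⁻¹' E) = m.withDensity w E := by
    intro x hx E hE hEa
    have hE' : MeasurableSet ((fun t => t - x) ⁻¹' E) := measurableSet_preimage (by fun_prop) hE
    let r : ℝ → ENNReal := fun t => ENNReal.ofReal (Real.exp ((t - x) ^ 2 / 2))
    have hr : Measurable r := by fun_prop
    have h1 : ∀ t, w t = gaussianShiftDensity x t * r t := fun t => by
      simp only [w, r, gaussianShiftDensity]
      rw [← ENNReal.ofReal_mul (by positivity), ← Real.exp_add]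
      congr 2; ring
    rw [hm' _ hE', hm' _ hE]
    have h2 : ∀ y : ℕ → ℝ,
        (D ∩ {y | y k ∈ (fun t => t - x) ⁻¹' E}).indicator (fun y => w (y k)) y
        = gaussianShiftDensity x (y k) *
          (D ∩ {y | y k ∈ (fun t => t - x) ⁻¹' E}).indicator (fun y => r (y k)) y := by
      intro y
      by_cases hy : y ∈ D ∩ {y | y k ∈ (fun t => t - x) ⁻¹' E}
      · simp only [Set.indicator_of_mem hy, h1]
      · simp only [Set.indicator_of_notMem hy, mul_zero]
    simp_rw [h2]
    have hF : Measurable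
        ((D ∩ {y | y k ∈ (fun t => t - x) ⁻¹' E}).indicator (fun y => r (y k))) :=
      (hr.comp hev).indicator (hD.inter (hev hE'))
    rw [← hμ.lintegral_coordShift k x hF.aemeasurable]
    refine lintegral_congr_ae ?_
    filter_upwards [hinv x hx] with y hy
    by_cases hyE : y k ∈ E
    · have := hy (hEa hyE)
      by_cases hyD : y ∈ D
      · rw [Set.indicator_of_mem, Set.indicator_of_mem]
        · simp [r, w]
        · exact ⟨hyD, hyE⟩
        · exact ⟨this.2 hyD, by simpa using hyE⟩
      · rw [Set.indicator_of_notMem, Set.indicator_of_notMem]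
        · exact fun h => hyD h.1
        · exact fun h => hyD (this.1 h.1)
    · rw [Set.indicator_of_notMem, Set.indicator_of_notMem]
      · exact fun h => hyE h.2
      · exact fun h => hyE (by simpa using h.2)
  set κ := m.withDensity w (Set.Ico a (a + 1)) with hκ
  have hvol : ∀ E, MeasurableSet E → E ⊆ Set.Ici a → m.withDensity w E = (κ • volume) E := by
    intro E hE hEa
    have := volume_mul_eq_of_translation_invariant htr measurableSet_Ico hE
      (D := Set.Ico a (a + 1))
      (fun t ht => ht.1) hEa
    rw [Measure.smul_apply, smul_eq_mul, mul_comm, ← this]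
    simp
  have hrest : (m.withDensity w).restrict (Set.Ici a) = (κ • volume).restrict (Set.Ici a) := by
    ext E hE
    rw [Measure.restrict_apply hE, Measure.restrict_apply hE]
    exact hvol _ (hE.inter measurableSet_Ici) Set.inter_subset_right
  have hmγ : ∃ c : ENNReal, ∀ E, MeasurableSet E → E ⊆ Set.Ici a →
      m E = c * gaussianReal 0 1 E := by
    let g : ℝ → ENNReal := fun t => (w t)⁻¹
    have hg : Measurable g := hw.inv
    refine ⟨κ * ENNReal.ofReal (√(2 * Real.pi)), fun E hE hEa => ?_⟩
    have e1 : m E = ∫⁻ t in E, g t ∂(m.withDensity w) := by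
      rw [setLIntegral_withDensity_eq_setLIntegral_mul _ hw hg hE]
      simp [g, ENNReal.mul_inv_cancel (hw0 _) (hwt _)]
    have e2 : (m.withDensity w).restrict E = κ • volume.restrict E := by
      rw [← Set.inter_eq_left.2 hEa, ← Measure.restrict_restrict hE, hrest,
        Measure.restrict_restrict hE, Measure.restrict_smul]
    rw [e1, e2, lintegral_smul_measure, gaussianReal_apply _ one_ne_zero, smul_eq_mul, mul_assoc,
      ← lintegral_const_mul _ (measurable_gaussianPDF _ _)]
    congr 1
    refine lintegral_congr fun t => ?_
    simp only [g, w, gaussianPDF, gaussianPDFReal]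
    rw [← ENNReal.ofReal_mul (by positivity), ← ENNReal.ofReal_inv_of_pos (by positivity),
      ← Real.exp_neg]
    congr 1
    simp only [NNReal.coe_one, mul_one, sub_zero]
    rw [← mul_assoc, mul_inv_cancel₀ (by positivity), one_mul]
    congr 1; ring
  obtain ⟨c, hc⟩ := hmγ
  have h2 := hc _ measurableSet_Ici subset_rfl
  rw [hmE _ measurableSet_Ici] at h2
  change μ (D ∩ {y | a ≤ y k}) = _ at h2
  rw [← hmE E hE, hc E hE hEa, h2]
  ring

lemma gaussianReal_Ici_ne_zero (a : ℝ) : gaussianReal 0 1 (Set.Ici a) ≠ 0 := fun h => by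
  simpa using gaussianReal_absolutelyContinuous' 0 one_ne_zero h

lemma measurableSet_box (a : ℕ → ℝ) : MeasurableSet {y : ℕ → ℝ | ∀ n, a n ≤ y n} :=
  measurableSet_Ici (a := a)

lemma coordShift_mem_box_iff {a : ℕ → ℝ} {k : ℕ} {x : ℝ} (hx : 0 ≤ x) {y : ℕ → ℝ}
    (hy : a k ≤ y k) :
    coordShift k x y ∈ {y : ℕ → ℝ | ∀ n, a n ≤ y n} ↔ y ∈ {y : ℕ → ℝ | ∀ n, a n ≤ y n} := by
  refine forall_congr' fun n => ?_
  by_cases h : n = k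
  · subst h; simp [hy, hx, le_add_of_le_of_nonneg]
  · rw [coordShift_of_ne h]

lemma IsGaussianProduct.measure_inter_box {μ : Measure (ℕ → ℝ)} (hμ : IsGaussianProduct μ)
    (a : ℕ → ℝ) {D : Set (ℕ → ℝ)} (hD : MeasurableSet D) (hDa : D ⊆ {y | ∀ n, a n ≤ y n})
    (hinv : ∀ k x, 0 ≤ x → ∀ᵐ y ∂μ, a k ≤ y k → (coordShift k x y ∈ D ↔ y ∈ D))
    (E : ℕ → Set ℝ) (hE : ∀ n, MeasurableSet (E n)) (hEa : ∀ n, E n ⊆ Set.Ici (a n))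
    (s : Finset ℕ) :
    μ (D ∩ {y | ∀ n ∈ s, y n ∈ E n}) * ∏ n ∈ s, gaussianReal 0 1 (Set.Ici (a n))
      = (∏ n ∈ s, gaussianReal 0 1 (E n)) * μ D := by
  induction s using Finset.induction_on with
  | empty => simp
  | insert k s hk ih =>
    set D' := D ∩ {y : ℕ → ℝ | ∀ n ∈ s, y n ∈ E n} with hD'
    have hD'm : MeasurableSet D' := by
      refine hD.inter ?_
      have : {y : ℕ → ℝ | ∀ n ∈ s, y n ∈ E n} = (s : Set ℕ).pi E := rfl
      rw [this]
      exact .pi (Finset.countable_toSet _) fun n _ => hE n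
    have hinv' : ∀ x, 0 ≤ x → ∀ᵐ y ∂μ, a k ≤ y k → (coordShift k x y ∈ D' ↔ y ∈ D') := by
      intro x hx
      filter_upwards [hinv k x hx] with y hy hak
      refine and_congr (hy hak) (forall₂_congr fun n hn => ?_)
      rw [coordShift_of_ne (ne_of_mem_of_not_mem hn hk)]
    have h1 := hμ.measure_inter_eval_mem k (a k) hD'm hinv' (hE k) (hEa k)
    have h2 : D' ∩ {y | a k ≤ y k} = D' := Set.inter_eq_left.2 fun y hy => hDa hy.1 k
    have h3 : D ∩ {y | ∀ n ∈ insert k s, y n ∈ E n} = D' ∩ {y | y k ∈ E k} := by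
      ext y
      simp only [hD', Set.mem_inter_iff, Set.mem_ofPred_eq, Finset.forall_mem_insert]
      tauto
    rw [h2] at h1
    rw [h3, Finset.prod_insert hk, Finset.prod_insert hk, ← mul_assoc, h1, mul_assoc, ih, mul_assoc]

/-- A zero-one law: a subset of a product of half-lines which is invariant under positive
translations in every coordinate has trivial Gaussian measure. -/
lemma IsGaussianProduct.zero_one {μ : Measure (ℕ → ℝ)} (hμ : IsGaussianProduct μ)
    (a : ℕ → ℝ) {D : Set (ℕ → ℝ)} (hD : MeasurableSet D) (hDa : D ⊆ {y | ∀ n, a n ≤ y n})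
    (hinv : ∀ k x, 0 ≤ x → ∀ᵐ y ∂μ, a k ≤ y k → (coordShift k x y ∈ D ↔ y ∈ D)) :
    μ D = 0 ∨ μ D = μ {y | ∀ n, a n ≤ y n} := by
  have := hμ.1
  set A := {y : ℕ → ℝ | ∀ n, a n ≤ y n} with hA
  have hAm : MeasurableSet A := measurableSet_box a
  have hinvA : ∀ k x, 0 ≤ x → ∀ᵐ y ∂μ, a k ≤ y k → (coordShift k x y ∈ A ↔ y ∈ A) :=
    fun k x hx => .of_forall fun y hy => coordShift_mem_box_iff hx hy
  have hbox : ∀ (s : Finset ℕ) (t : ℕ → Set ℝ), (∀ n, MeasurableSet (t n)) →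
      μ (D ∩ (s : Set ℕ).pi t) * μ A = μ (A ∩ (s : Set ℕ).pi t) * μ D := by
    intro s t ht
    let E : ℕ → Set ℝ := fun n => t n ∩ Set.Ici (a n)
    have hEs : ∀ B ⊆ A, B ∩ (s : Set ℕ).pi t = B ∩ {y | ∀ n ∈ s, y n ∈ E n} := by
      intro B hB
      ext y
      simp only [Set.mem_inter_iff, Set.mem_pi, Finset.mem_coe, Set.mem_ofPred_eq, E, Set.mem_Ici]
      exact and_congr_right fun hy => forall₂_congr fun n hn => by
        simp [show a n ≤ y n from hB hy n]
    have hEm : ∀ n, MeasurableSet (E n) := fun n => (ht n).inter measurableSet_Ici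
    have hEa : ∀ n, E n ⊆ Set.Ici (a n) := fun n => Set.inter_subset_right
    have e1 := hμ.measure_inter_box a hD hDa hinv E hEm hEa s
    have e2 := hμ.measure_inter_box a hAm subset_rfl hinvA E hEm hEa s
    rw [hEs D hDa, hEs A subset_rfl]
    have hp0 : ∏ n ∈ s, gaussianReal 0 1 (Set.Ici (a n)) ≠ 0 :=
      Finset.prod_ne_zero_iff.2 fun n _ => gaussianReal_Ici_ne_zero _
    have hpt : ∏ n ∈ s, gaussianReal 0 1 (Set.Ici (a n)) ≠ ⊤ :=
      ENNReal.prod_ne_top fun n _ => measure_ne_top _ _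
    rw [← ENNReal.mul_left_inj hp0 hpt, mul_right_comm, e1, mul_right_comm (μ (A ∩ _)) (μ D), e2,
      mul_right_comm]
  have hmeas : (μ A) • μ.restrict D = (μ D) • μ.restrict A := by
    have hfin : IsFiniteMeasure ((μ A) • μ.restrict D) :=
      Measure.smul_finite _ (measure_ne_top _ _)
    refine ext_of_generate_finite _ (generateFrom_squareCylinders (α := fun _ : ℕ => ℝ)).symm
      (isPiSystem_squareCylinders (fun _ => MeasurableSpace.isPiSystem_measurableSet)
        fun _ => Set.mem_ofPred_eq ▸ MeasurableSet.univ) ?_ ?_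
    · rintro _ ⟨s, t, ht, rfl⟩
      have ht' : ∀ n, MeasurableSet (t n) := fun n => ht n trivial
      have hpm : MeasurableSet ((s : Set ℕ).pi t) :=
        .pi (Finset.countable_toSet _) fun n _ => ht' n
      have := hbox s t ht'
      simp only [Measure.smul_apply, smul_eq_mul, Measure.restrict_apply hpm]
      rw [Set.inter_comm, mul_comm, this, Set.inter_comm, mul_comm]
    · simp [mul_comm]
  have h := congrArg (fun ν => ν D) hmeas
  simp only [Measure.smul_apply, smul_eq_mul, Measure.restrict_apply hD, Set.inter_self,
    Set.inter_eq_left.2 hDa] at h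
  by_cases h0 : μ D = 0
  · exact .inl h0
  · exact .inr ((ENNReal.mul_left_inj h0 (measure_ne_top _ _)).1 h).symm

/-- `T` commutes with multiplication by the indicator function of `B`. -/
def CommutesIndicator {Ω : Type*} [MeasurableSpace Ω] {ν : Measure Ω}
    (T : Lp ℂ 2 ν →L[ℂ] Lp ℂ 2 ν) (B : Set Ω) : Prop :=
  ∀ f f' : Lp ℂ 2 ν, f' =ᵐ[ν] B.indicator f → T f' =ᵐ[ν] B.indicator (T f)

lemma CommutesIndicator.inter {Ω : Type*} [MeasurableSpace Ω] {ν : Measure Ω}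
    {T : Lp ℂ 2 ν →L[ℂ] Lp ℂ 2 ν} {B C : Set Ω} (hB : CommutesIndicator T B)
    (hC : CommutesIndicator T C) (hCm : MeasurableSet C) : CommutesIndicator T (B ∩ C) := by
  intro f f' hf'
  have hm : MemLp (C.indicator f) 2 ν := (Lp.memLp f).indicator hCm
  have h1 : hm.toLp _ =ᵐ[ν] C.indicator f := hm.coeFn_toLp
  have h2 : f' =ᵐ[ν] B.indicator (hm.toLp _) := by
    filter_upwards [hf', h1] with y hy h1y
    rw [hy, ← Set.indicator_indicator]
    by_cases hyB : y ∈ B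
    · simp only [Set.indicator_of_mem hyB, h1y]
    · simp only [Set.indicator_of_notMem hyB]
  filter_upwards [hB _ _ h2, hC _ _ h1] with y hy h1y
  rw [hy, ← Set.indicator_indicator]
  by_cases hyB : y ∈ B
  · simp only [Set.indicator_of_mem hyB, h1y]
  · simp only [Set.indicator_of_notMem hyB]

lemma CommutesIndicator.of_commute {Ω : Type*} [MeasurableSpace Ω] {ν : Measure Ω}
    {T Q : Lp ℂ 2 ν →L[ℂ] Lp ℂ 2 ν} {B : Set Ω} (hTQ : Commute T Q)
    (hQ : ∀ f, Q f =ᵐ[ν] B.indicator f) : CommutesIndicator T B := by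
  intro f f' hf'
  have : f' = Q f := Lp.ext (hf'.trans (hQ f).symm)
  have h : T (Q f) = Q (T f) := DFunLike.congr_fun hTQ f
  rw [this, h]
  exact hQ (T f)

lemma ae_eq_of_setIntegral_eq_of_isPiSystem {Ω : Type*} {m : MeasurableSpace Ω} {ν : Measure Ω}
    {f g : Ω → ℂ} (hf : Integrable f ν) (hg : Integrable g ν)
    {C : Set (Set Ω)} (hgen : m = MeasurableSpace.generateFrom C) (hpi : IsPiSystem C)
    (huniv : Set.univ ∈ C) (h : ∀ B ∈ C, ∫ y in B, f y ∂ν = ∫ y in B, g y ∂ν) : f =ᵐ[ν] g := by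
  suffices key : ∀ s, MeasurableSet s → ∫ y in s, f y ∂ν = ∫ y in s, g y ∂ν from
    Integrable.ae_eq_of_forall_setIntegral_eq f g hf hg fun s hs _ => key s hs
  intro s hs
  induction s, hs using MeasurableSpace.induction_on_inter hgen hpi with
  | empty => simp
  | basic t ht => exact h t ht
  | compl t ht ih =>
    have hu := h _ huniv
    simp only [setIntegral_univ] at hu
    rw [setIntegral_compl ht hf, setIntegral_compl ht hg, ih, hu]
  | iUnion F hd hm ih =>
    rw [integral_iUnion hm hd hf.integrableOn, integral_iUnion hm hd hg.integrableOn]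
    exact tsum_congr ih

/-- If an operator commutes with sufficiently many indicator functions, then its adjoint is a
multiplication operator. -/
lemma exists_adjoint_eq_mul {Ω : Type*} {m : MeasurableSpace Ω} {ν : Measure Ω}
    [IsFiniteMeasure ν] {T : Lp ℂ 2 ν →L[ℂ] Lp ℂ 2 ν}
    (hgen : m ≤ MeasurableSpace.generateFrom {B | MeasurableSet B ∧ CommutesIndicator T B}) :
    ∃ ψ : Ω → ℂ, Measurable ψ ∧ ∀ g, adjoint T g =ᵐ[ν] fun y => ψ y * g y := by
  let one : Lp ℂ 2 ν := indicatorConstLp 2 MeasurableSet.univ (measure_ne_top ν _) 1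
  refine ⟨fun y => starRingEnd ℂ (T one y),
    Complex.continuous_conj.measurable.comp (Lp.stronglyMeasurable (T one)).measurable, fun g => ?_⟩
  have hint : Integrable (fun y => starRingEnd ℂ (T one y) * g y) ν := by
    simpa [RCLike.inner_apply, mul_comm] using L2.integrable_inner (𝕜 := ℂ) (T one) g
  refine ae_eq_of_setIntegral_eq_of_isPiSystem ((Lp.memLp (adjoint T g)).integrable one_le_two)
    hint (le_antisymm hgen (MeasurableSpace.generateFrom_le fun B hB => hB.1))
    (fun B hB C hC _ => ⟨hB.1.inter hC.1, hB.2.inter hC.2 hC.1⟩)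
    ⟨.univ, fun f f' hf' => ?_⟩ fun B hB => ?_
  · have : f' = f := Lp.ext (by simpa using hf')
    simp [this]
  · have h1 : ((indicatorConstLp 2 hB.1 (measure_ne_top ν B) (1 : ℂ) : Lp ℂ 2 ν) : Ω → ℂ)
        =ᵐ[ν] B.indicator one := by
      filter_upwards [indicatorConstLp_coeFn (p := 2) (hs := hB.1) (hμs := measure_ne_top ν B)
        (c := (1 : ℂ)), indicatorConstLp_coeFn (p := 2) (hs := MeasurableSet.univ)
        (hμs := measure_ne_top ν Set.univ) (c := (1 : ℂ))] with y hy h1y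
      rw [hy]
      by_cases hyB : y ∈ B
      · simp only [Set.indicator_of_mem hyB]; simpa [one] using h1y.symm
      · simp only [Set.indicator_of_notMem hyB]
    rw [← L2.inner_indicatorConstLp_one (𝕜 := ℂ) hB.1 (measure_ne_top ν B),
      adjoint_inner_right, L2.inner_def, ← integral_indicator hB.1]
    refine integral_congr_ae ?_
    filter_upwards [hB.2 _ _ h1] with y hy
    rw [hy]
    by_cases hyB : y ∈ B
    · simp [Set.indicator_of_mem hyB, RCLike.inner_apply, mul_comm]
    · simp [Set.indicator_of_notMem hyB]

/-- `W` is the isometry of `L²(A)` given by the translation by `x` in the coordinate `k`. -/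
def IsCoordShiftIsometry (μ : Measure (ℕ → ℝ)) (A : Set (ℕ → ℝ)) (k : ℕ) (x : ℝ)
    (W : Lp ℂ 2 (μ.restrict A) →L[ℂ] Lp ℂ 2 (μ.restrict A)) : Prop :=
  (∀ f, ‖W f‖ = ‖f‖) ∧
  ∀ f, W f =ᵐ[μ.restrict A] {y | coordShift k (-x) y ∈ A}.indicator
    (fun y => (Real.exp ((x * y k - x ^ 2 / 2) / 2) : ℂ) * f (coordShift k (-x) y))

lemma IsGaussianShiftRep.isCoordShiftIsometry {μ : Measure (ℕ → ℝ)} {A : Set (ℕ → ℝ)}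
    {V : (ℕ → NNReal) → (Lp ℂ 2 (μ.restrict A) →L[ℂ] Lp ℂ 2 (μ.restrict A))}
    (hV : IsGaussianShiftRep μ A V) (k : ℕ) (x : NNReal) :
    IsCoordShiftIsometry μ A k x (V (Pi.single k x)) := by
  have hsupp : ∀ n, k + 1 ≤ n → (Pi.single k x : ℕ → NNReal) n = 0 := fun n hn =>
    Pi.single_eq_of_ne (by omega) _
  refine ⟨hV.1 _ ⟨k + 1, hsupp⟩, fun f => (hV.2 _ (k + 1) hsupp f).trans (.of_eq ?_)⟩
  have hshift : ∀ y : ℕ → ℝ,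
      (fun n => y n - ((Pi.single k x : ℕ → NNReal) n : ℝ)) = coordShift k (-x) y := by
    intro y
    ext n
    by_cases h : n = k
    · subst h; simp [sub_eq_add_neg]
    · rw [coordShift_of_ne h]; simp [h]
  have hprod : ∀ y : ℕ → ℝ, Real.sqrt (∏ n ∈ Finset.range (k + 1),
      Real.exp ((2 * ((Pi.single k x : ℕ → NNReal) n : ℝ) * y n
        - ((Pi.single k x : ℕ → NNReal) n : ℝ) ^ 2) / 2))
      = Real.exp ((x * y k - x ^ 2 / 2) / 2) := by
    intro y
    rw [Finset.prod_eq_single k (fun n _ hn => by simp [hn]) (by simp), Pi.single_eq_same,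
      ← Real.exp_half]
    ring_nf
  simp only [hshift, hprod]

lemma IsGaussianProduct.ae_restrict_coordShift {μ : Measure (ℕ → ℝ)} (hμ : IsGaussianProduct μ)
    {A : Set (ℕ → ℝ)} (hA : MeasurableSet A) {p : (ℕ → ℝ) → Prop}
    (hp : ∀ᵐ y ∂(μ.restrict A), p y) (k : ℕ) (x : ℝ) :
    ∀ᵐ y ∂μ, coordShift k x y ∈ A → p (coordShift k x y) :=
  (hμ.quasiMeasurePreserving_coordShift k x).ae ((ae_restrict_iff' hA).1 hp)

lemma coordShift_neg_mem_box_iff {a : ℕ → ℝ} {k : ℕ} {x : ℝ} {y : ℕ → ℝ}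
    (hy : y ∈ {y : ℕ → ℝ | ∀ n, a n ≤ y n}) :
    coordShift k (-x) y ∈ {y : ℕ → ℝ | ∀ n, a n ≤ y n} ↔ a k + x ≤ y k := by
  constructor
  · intro h
    have := h k
    rw [coordShift_same] at this
    linarith
  · intro h n
    by_cases hn : n = k
    · subst hn; rw [coordShift_same]; linarith
    · rw [coordShift_of_ne hn]; exact hy n

/-- The range of a coordinate translation isometry contains all functions supported on the
translated set. -/
lemma IsCoordShiftIsometry.exists_apply_eq {μ : Measure (ℕ → ℝ)} (hμ : IsGaussianProduct μ)
    {A : Set (ℕ → ℝ)} (hA : MeasurableSet A) {k : ℕ} {x : ℝ}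
    {W : Lp ℂ 2 (μ.restrict A) →L[ℂ] Lp ℂ 2 (μ.restrict A)}
    (hW : IsCoordShiftIsometry μ A k x W) (f : Lp ℂ 2 (μ.restrict A)) :
    ∃ g, W g =ᵐ[μ.restrict A] {y | coordShift k (-x) y ∈ A}.indicator f := by
  let h : (ℕ → ℝ) → ℂ := fun y =>
    (Real.exp (-((x * y k - x ^ 2 / 2) / 2)) : ℂ) * A.indicator f y
  have hind : AEStronglyMeasurable (A.indicator f) μ :=
    (aestronglyMeasurable_indicator_iff hA).2 (Lp.aestronglyMeasurable f)
  have hev : Measurable (fun y : ℕ → ℝ => y k) := measurable_pi_apply k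
  have hh : AEStronglyMeasurable h μ :=
    Measurable.aestronglyMeasurable (by fun_prop) |>.mul hind
  have hg : MemLp (fun y => h (coordShift k x y)) 2 (μ.restrict A) := by
    refine ⟨(hh.comp_quasiMeasurePreserving
      (hμ.quasiMeasurePreserving_coordShift k x)).restrict, ?_⟩
    rw [eLpNorm_lt_top_iff_lintegral_rpow_enorm_lt_top two_ne_zero ENNReal.ofNat_ne_top]
    have hf := (eLpNorm_lt_top_iff_lintegral_rpow_enorm_lt_top two_ne_zero
      ENNReal.ofNat_ne_top).1 (Lp.eLpNorm_lt_top f)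
    refine lt_of_le_of_lt ?_ hf
    refine (setLIntegral_le_lintegral _ _).trans (le_of_eq ?_)
    rw [hμ.lintegral_coordShift k x (F := fun y => ‖h y‖ₑ ^ (2 : ENNReal).toReal)
      (hh.enorm.pow_const _), ← lintegral_indicator hA]
    refine lintegral_congr fun y => ?_
    by_cases hy : y ∈ A
    · simp only [h, Set.indicator_of_mem hy, enorm_mul, ENNReal.toReal_ofNat, ENNReal.rpow_ofNat,
        mul_pow, ← mul_assoc]
      have : gaussianShiftDensity x (y k)
          * ‖(Real.exp (-((x * y k - x ^ 2 / 2) / 2)) : ℂ)‖ₑ ^ 2 = 1 := by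
        rw [← ofReal_norm, Complex.norm_real, Real.norm_of_nonneg (Real.exp_pos _).le,
          ← ENNReal.ofReal_pow (Real.exp_pos _).le, gaussianShiftDensity,
          ← ENNReal.ofReal_mul (Real.exp_pos _).le, ← Real.exp_nat_mul, ← Real.exp_add]
        rw [← ENNReal.ofReal_one, ← Real.exp_zero]
        congr 2; push_cast; ring
      rw [this, one_mul]
    · simp [h, Set.indicator_of_notMem hy]
  refine ⟨hg.toLp _, (hW.2 _).trans ?_⟩
  filter_upwards [ae_restrict_of_ae (hμ.ae_restrict_coordShift hA hg.coeFn_toLp k (-x)),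
    ae_restrict_mem hA] with y hy hyA
  by_cases hyB : y ∈ {y | coordShift k (-x) y ∈ A}
  · simp only [Set.indicator_of_mem hyB, hy hyB, h, coordShift_coordShift_neg,
      Set.indicator_of_mem hyA]
    rw [← mul_assoc, ← Complex.ofReal_mul, ← Real.exp_add]
    simp
  · simp only [Set.indicator_of_notMem hyB]

lemma IsCoordShiftIsometry.apply_adjoint {μ : Measure (ℕ → ℝ)} (hμ : IsGaussianProduct μ)
    {A : Set (ℕ → ℝ)} (hA : MeasurableSet A) {k : ℕ} {x : ℝ}
    {W : Lp ℂ 2 (μ.restrict A) →L[ℂ] Lp ℂ 2 (μ.restrict A)}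
    (hW : IsCoordShiftIsometry μ A k x W) (f : Lp ℂ 2 (μ.restrict A)) :
    W (adjoint W f) =ᵐ[μ.restrict A] {y | coordShift k (-x) y ∈ A}.indicator f := by
  obtain ⟨g, hg⟩ := hW.exists_apply_eq hμ hA f
  have hWW : adjoint W (W g) = g :=
    DFunLike.congr_fun ((norm_map_iff_adjoint_comp_self W).1 hW.1) g
  have h0 : adjoint W (f - W g) = 0 := by
    refine ext_inner_right ℂ fun u => ?_
    rw [adjoint_inner_left, inner_zero_left, L2.inner_def]
    refine integral_eq_zero_of_ae ?_
    filter_upwards [hg, hW.2 u, Lp.coeFn_sub f (W g)] with y hgy huy hsub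
    rw [hsub, huy, Pi.sub_apply, hgy]
    by_cases hyB : y ∈ {y | coordShift k (-x) y ∈ A}
    · simp [Set.indicator_of_mem hyB]
    · simp [Set.indicator_of_notMem hyB]
  rw [map_sub, hWW, sub_eq_zero] at h0
  rwa [h0]

lemma measurableSpace_le_generateFrom_eval_ge :
    (inferInstance : MeasurableSpace (ℕ → ℝ)) ≤
      MeasurableSpace.generateFrom {B | ∃ (k : ℕ) (b : ℝ), B = {y : ℕ → ℝ | b ≤ y k}} := by
  refine iSup_le fun k => ?_
  rw [(BorelSpace.measurable_eq (α := ℝ)).trans (borel_eq_generateFrom_Ici ℝ),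
    MeasurableSpace.comap_generateFrom]
  refine MeasurableSpace.generateFrom_mono ?_
  rintro _ ⟨_, ⟨b, rfl⟩, rfl⟩
  exact ⟨k, b, rfl⟩

/-- the representation `V^A` of `ℝ₊^∞` on `L²(A)` is irreducible: any bounded
operator commuting with all `V^A_x` and their adjoints is a scalar multiple of the identity. -/
theorem stmt_16 (μ : Measure (ℕ → ℝ)) (hμ : IsGaussianProduct μ)
    (a : ℕ → ℝ) (ha : ∀ n, a n ≤ 0)
    (hprod : ∃ L : ℝ, 0 < L ∧
      Tendsto (fun N : ℕ => ∏ n ∈ Finset.range N,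
          (ProbabilityTheory.gaussianReal 0 1 (Set.Ici (a n))).toReal) atTop (𝓝 L))
    (A : Set (ℕ → ℝ)) (hA : A = {y : ℕ → ℝ | ∀ n, a n ≤ y n})
    (V : (ℕ → NNReal) → (Lp ℂ 2 (μ.restrict A) →L[ℂ] Lp ℂ 2 (μ.restrict A)))
    (hV : IsGaussianShiftRep μ A V)
    (T : Lp ℂ 2 (μ.restrict A) →L[ℂ] Lp ℂ 2 (μ.restrict A))
    (hT : ∀ x : ℕ → NNReal, (∃ k, ∀ n, k ≤ n → x n = 0) →
      T * V x = V x * T ∧ T * adjoint (V x) = adjoint (V x) * T) :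
    ∃ c : ℂ, T = c • 1 := by
  have := hμ.1
  have hAm : MeasurableSet A := hA ▸ measurableSet_box a
  have hW : ∀ k (x : NNReal), IsCoordShiftIsometry μ A k x (V (Pi.single k x)) :=
    hV.isCoordShiftIsometry
  have hT1 : ∀ k (x : NNReal), Commute T (V (Pi.single k x)) ∧
      Commute T (adjoint (V (Pi.single k x))) := fun k x =>
    hT _ ⟨k + 1, fun n hn => Pi.single_eq_of_ne (by omega) _⟩
  have hcomm : ∀ k b, CommutesIndicator (adjoint T) {y : ℕ → ℝ | b ≤ y k} := by
    intro k b
    have h1 : Commute (adjoint T) (V (Pi.single k (b - a k).toNNReal)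
        * adjoint (V (Pi.single k (b - a k).toNNReal))) := by
      have := ((hT1 k (b - a k).toNNReal).1.mul_right (hT1 k (b - a k).toNNReal).2).star_star
      simpa only [star_mul, star_eq_adjoint, adjoint_adjoint] using this
    refine .of_commute h1 fun f => ((hW k _).apply_adjoint hμ hAm f).trans ?_
    filter_upwards [ae_restrict_mem hAm] with y hy
    have hiff : coordShift k (-((b - a k).toNNReal : ℝ)) y ∈ A ↔ b ≤ y k := by
      subst hA
      rw [coordShift_neg_mem_box_iff hy, Real.coe_toNNReal', ← max_add_add_left]
      have := hy k
      simp [this]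
    simp only [Set.indicator, Set.mem_ofPred_eq, hiff]
  obtain ⟨ψ, hψm, hψ⟩ := exists_adjoint_eq_mul (T := adjoint T)
    (measurableSpace_le_generateFrom_eval_ge.trans (MeasurableSpace.generateFrom_mono (by
      rintro _ ⟨k, b, rfl⟩
      exact ⟨measurable_pi_apply k measurableSet_Ici, hcomm k b⟩)))
  simp only [adjoint_adjoint] at hψ
  have hinv : ∀ k (x : ℝ), 0 ≤ x → ∀ᵐ y ∂μ, y ∈ A → ψ (coordShift k x y) = ψ y := by
    intro k x hx
    lift x to NNReal using hx
    let one : Lp ℂ 2 (μ.restrict A) := indicatorConstLp 2 MeasurableSet.univ (measure_ne_top _ _) 1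
    have hone : one =ᵐ[μ.restrict A] fun _ => 1 := by
      simpa [one] using indicatorConstLp_coeFn (μ := μ.restrict A) (p := 2)
        (hs := MeasurableSet.univ) (hμs := measure_ne_top _ Set.univ) (c := (1 : ℂ))
    set W := V (Pi.single k x) with hWdef
    have hTW : T (W one) = W (T one) := DFunLike.congr_fun (hT1 k x).1 one
    have h1 : ∀ᵐ y ∂(μ.restrict A), coordShift k (-x) y ∈ A →
        ψ y = ψ (coordShift k (-x) y) := by
      have e1 := hψ (W one)
      rw [hTW] at e1
      filter_upwards [e1, (hW k x).2 one, (hW k x).2 (T one),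
        ae_restrict_of_ae (hμ.ae_restrict_coordShift hAm hone k (-x)),
        ae_restrict_of_ae (hμ.ae_restrict_coordShift hAm (hψ one) k (-x))]
        with y e1 e2 e3 e4 e5 hy
      have hy' : y ∈ {y | coordShift k (-x) y ∈ A} := hy
      rw [e3, e2, Set.indicator_of_mem hy', Set.indicator_of_mem hy', e5 hy, e4 hy, mul_one,
        mul_one, mul_comm] at e1
      exact (mul_right_cancel₀ (by exact_mod_cast (Real.exp_pos _).ne') e1).symm
    filter_upwards [hμ.ae_restrict_coordShift hAm h1 k x] with y hy hyA
    rw [coordShift_neg_coordShift] at hy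
    refine hy ?_ hyA
    subst hA
    exact (coordShift_mem_box_iff x.2 (hyA k)).2 hyA
  have hconst : ∃ c, ψ =ᵐ[μ.restrict A] Function.const _ c := by
    refine exists_eventuallyEq_const_of_forall_separating MeasurableSet fun U hU => ?_
    have hD : MeasurableSet (A ∩ ψ ⁻¹' U) := hAm.inter (hψm hU)
    rcases hμ.zero_one a hD (hA ▸ Set.inter_subset_left) (fun k x hx => by
      filter_upwards [hinv k x hx] with y hy hak
      have hmem : coordShift k x y ∈ A ↔ y ∈ A := by
        rw [hA]; exact coordShift_mem_box_iff hx hak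
      simp only [Set.mem_inter_iff, hmem, Set.mem_preimage]
      exact and_congr_right fun h => by rw [hy h]) with h | h
    · right
      rw [ae_restrict_iff' hAm]
      filter_upwards [measure_eq_zero_iff_ae_notMem.1 h] with y hy hyA hyU
      exact hy ⟨hyA, hyU⟩
    · left
      rw [← hA] at h
      have h2 := ae_eq_of_subset_of_measure_ge (Set.inter_subset_left (s := A) (t := ψ ⁻¹' U))
        h.ge hD.nullMeasurableSet (measure_ne_top _ _)
      rw [ae_restrict_iff' hAm]
      filter_upwards [h2.mem_iff] with y hy hyA
      exact (hy.2 hyA).2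
  obtain ⟨c, hc⟩ := hconst
  refine ⟨c, ContinuousLinearMap.ext fun g => Lp.ext ?_⟩
  filter_upwards [hψ g, hc, Lp.coeFn_smul c g] with y h1 h2 h3
  rw [h1, h2, Function.const_apply]
  exact h3.symm
end
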